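/- arXiv:2108.00059 — 2 statements merged into one kernel-verified Lean document; each statement's English description precedes it below -/
import Mathlib

section
/- Every 2-connected C_5-minor-free graph G satisfies at least one of the following: G has at most 4 vertices; G is isomorphic to the complete bipartite graph K_{2,p} for some p; or G is isomorphic to K'_{2,p}, the graph obtained from K_{2,p} by adding the edge between the two vertices of the part of size 2, for some p. -/
open SimpleGraph

variable {α β : Type*}

/-- A model of `H` in `G`: a family of pairwise disjoint nonempty vertex subsets of `G`,
each inducing a connected subgraph, such that for every edge `h h'` of `H` there is an
edge of `G` between `V h` and `V h'`. -/
def IsMinorModel (G : SimpleGraph α) (H : SimpleGraph β) (V : β → Set α) : Prop :=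
  (∀ h, (V h).Nonempty) ∧
  (Pairwise fun h h' => Disjoint (V h) (V h')) ∧
  (∀ h, (G.induce (V h)).Connected) ∧
  ∀ h h', H.Adj h h' → ∃ x ∈ V h, ∃ y ∈ V h', G.Adj x y

/-- `H` is a minor of `G`. -/
def HasMinor (G : SimpleGraph α) (H : SimpleGraph β) : Prop :=
  ∃ V : β → Set α, IsMinorModel G H V

/-- `G` is `H`-minimal: `H` is a minor of `G`, but for every vertex `x` of `G`,
`H` is not a minor of `G − x`. -/
def MinorMinimal (G : SimpleGraph α) (H : SimpleGraph β) : Prop :=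
  HasMinor G H ∧ ∀ x : α, ¬ HasMinor (G.induce {y | y ≠ x}) H

/-- A graph is 2-connected if it has at least 3 vertices, is connected, and stays
connected after deleting any single vertex. -/
def TwoConnected [Fintype α] (G : SimpleGraph α) : Prop :=
  3 ≤ Fintype.card α ∧ G.Connected ∧ ∀ v : α, (G.induce {w | w ≠ v}).Connected

/-- `G` is a cycle: connected and 2-regular. -/
def IsCycleGraph (G : SimpleGraph α) : Prop :=
  G.Connected ∧ ∀ v : α, (G.neighborSet v).ncard = 2

/-- `K'_{2,p}`: the complete bipartite graph `K_{2,p}` plus the edge between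
the two vertices of the part of size 2. -/
def K2pPlusEdge (p : ℕ) : SimpleGraph (Fin 2 ⊕ Fin p) :=
  completeBipartiteGraph (Fin 2) (Fin p) ⊔ fromEdgeSet {s(Sum.inl 0, Sum.inl 1)}

namespace SimpleGraph

/-- A path on at least five vertices with adjacent ends yields a `C₅` minor. -/
theorem hasMinor_cycleGraph_five_of_isPath {G : SimpleGraph α} {u v : α} (p : G.Walk u v)
    (hp : p.IsPath) (hl : 4 ≤ p.length) (huv : G.Adj u v) : HasMinor G (cycleGraph 5) := by
  match p, hp, hl with
  | .cons (v := b) h₁ (.cons (v := c) h₂ (.cons (v := d) h₃ (.cons (v := e) h₄ q))), hp, _ =>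
    simp only [Walk.cons_isPath_iff, Walk.support_cons, List.mem_cons, not_or] at hp
    refine ⟨![{u}, {b}, {c}, {d}, {z | z ∈ q.support}], ?_, ?_, ?_, ?_⟩
    · intro i
      fin_cases i <;> simp
    · intro i j hij
      fin_cases i <;> fin_cases j <;> simp at hij ⊢ <;> grind
    · intro i
      fin_cases i
      iterate 4 · simp
      · exact q.connected_induce_support
    · have hs := q.start_mem_support
      have he := q.end_mem_support
      intro i j hij
      fin_cases i <;> fin_cases j <;> first
        | (exfalso; revert hij; decide)
        | (simp; first
            | assumption
            | (apply SimpleGraph.Adj.symm; assumption)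
            | exact ⟨_, hs, h₄⟩
            | exact ⟨_, hs, h₄.symm⟩
            | exact ⟨_, he, huv⟩ | exact ⟨_, he, huv.symm⟩)

/-- `t` can be reached from `s` in `G` without meeting `C`. -/
def ReachableAvoiding (G : SimpleGraph α) (C : Set α) (s t : α) : Prop :=
  ∃ w : G.Walk s t, ∀ z ∈ w.support, z ∉ C

namespace ReachableAvoiding

variable {G : SimpleGraph α} {C : Set α} {r s t : α}

theorem symm (h : G.ReachableAvoiding C s t) : G.ReachableAvoiding C t s := by
  obtain ⟨w, hw⟩ := h
  exact ⟨w.reverse, by simpa using hw⟩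

theorem trans (h : G.ReachableAvoiding C r s) (h' : G.ReachableAvoiding C s t) :
    G.ReachableAvoiding C r t := by
  obtain ⟨w, hw⟩ := h
  obtain ⟨w', hw'⟩ := h'
  refine ⟨w.append w', fun z hz => ?_⟩
  rw [Walk.mem_support_append_iff] at hz
  exact hz.elim (hw z) (hw' z)

theorem notMem_left (h : G.ReachableAvoiding C s t) : s ∉ C := by
  obtain ⟨w, hw⟩ := h
  exact hw _ w.start_mem_support

theorem exists_isPath (h : G.ReachableAvoiding C s t) :
    ∃ w : G.Walk s t, w.IsPath ∧ ∀ z ∈ w.support, z ∉ C := by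
  classical
  obtain ⟨w, hw⟩ := h
  exact ⟨w.bypass, w.bypass_isPath, fun z hz => hw z (w.support_bypass_subset_support hz)⟩

end ReachableAvoiding

theorem Walk.exists_first_mem {G : SimpleGraph α} {C : Set α} {s c : α} (w : G.Walk s c)
    (hs : s ∉ C) (hc : c ∈ C) :
    ∃ t c', c' ∈ C ∧ t ∈ w.support ∧ c' ∈ w.support ∧ G.Adj t c' ∧
      G.ReachableAvoiding C s t := by
  induction w with
  | nil => exact absurd hc hs
  | @cons s s' c h w ih =>
    by_cases hs' : s' ∈ C
    · exact ⟨s, s', hs', by simp, by simp, h, .nil, by simpa using hs⟩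
    · obtain ⟨t, c', h₁, h₂, h₃, h₄, w', hw'⟩ := ih hs' hc
      refine ⟨t, c', h₁, by simp [h₂], by simp [h₃], h₄, .cons h w', ?_⟩
      simpa using ⟨hs, hw'⟩

theorem exists_walk_notMem_support {G : SimpleGraph α} {v : α}
    (h : (G.induce {w | w ≠ v}).Connected) {s t : α} (hs : s ≠ v) (ht : t ≠ v) :
    ∃ w : G.Walk s t, v ∉ w.support := by
  obtain ⟨w⟩ := h.preconnected ⟨s, hs⟩ ⟨t, ht⟩
  let f := (Embedding.induce (G := G) {w | w ≠ v}).toHom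
  have hf : ∀ {p q : {w | w ≠ v}} (w : (G.induce {w | w ≠ v}).Walk p q),
      v ∉ (w.map f).support := by
    intro p q w hv
    rw [Walk.support_map] at hv
    obtain ⟨z, -, hz⟩ := List.mem_map.1 hv
    exact z.2 hz
  exact ⟨w.map f, hf w⟩

/-- The vertices `a, x, b, y` form a four-cycle, in this order. -/
structure IsFourCycle (G : SimpleGraph α) (a x b y : α) : Prop where
  adj₁ : G.Adj a x
  adj₂ : G.Adj x b
  adj₃ : G.Adj b y
  adj₄ : G.Adj y a
  ne₁ : a ≠ b
  ne₂ : x ≠ y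

namespace IsFourCycle

variable {G : SimpleGraph α} {a x b y s t : α}

theorem rotate (h : G.IsFourCycle a x b y) : G.IsFourCycle x b y a :=
  ⟨h.adj₂, h.adj₃, h.adj₄, h.adj₁, h.ne₂, h.ne₁.symm⟩

theorem not_adj_consecutive (h : G.IsFourCycle a x b y) (hfree : ¬ HasMinor G (cycleGraph 5))
    (hst : G.ReachableAvoiding {a, x, b, y} s t) (hs : G.Adj s a) : ¬ G.Adj t x := by
  intro ht
  obtain ⟨p, hp, hC⟩ := hst.exists_isPath
  have hC' : ∀ z ∈ ({a, x, b, y} : Set α), z ∉ p.support := fun z hz hz' => hC z hz' hz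
  simp only [Set.mem_insert_iff, Set.mem_singleton_iff, forall_eq_or_imp, forall_eq] at hC'
  refine hfree (hasMinor_cycleGraph_five_of_isPath
    (.cons h.adj₂ (.cons h.adj₃ (.cons h.adj₄ (.cons hs.symm p)))) ?_ (by simp) ht.symm)
  have := h.adj₁.ne; have := h.adj₂.ne; have := h.adj₃.ne; have := h.adj₄.ne
  have := h.ne₁; have := h.ne₂
  simp only [Walk.cons_isPath_iff, Walk.support_cons, List.mem_cons]
  grind

theorem eq_of_adj_opposite (h : G.IsFourCycle a x b y) (hfree : ¬ HasMinor G (cycleGraph 5))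
    (hst : G.ReachableAvoiding {a, x, b, y} s t) (hs : G.Adj s a) (ht : G.Adj t b) : s = t := by
  obtain ⟨p, hp, hC⟩ := hst.exists_isPath
  have hC' : ∀ z ∈ ({a, x, b, y} : Set α), z ∉ p.support := fun z hz hz' => hC z hz' hz
  simp only [Set.mem_insert_iff, Set.mem_singleton_iff, forall_eq_or_imp, forall_eq] at hC'
  by_contra hne
  have hlen : p.length ≠ 0 := fun h0 => hne (Walk.eq_of_length_eq_zero h0)
  refine hfree (hasMinor_cycleGraph_five_of_isPath
    (.cons h.adj₂.symm (.cons h.adj₁.symm (.cons hs.symm p))) ?_ (by simp; omega) ht.symm)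
  have := h.adj₁.ne; have := h.adj₂.ne
  have := h.ne₁
  simp only [Walk.cons_isPath_iff, Walk.support_cons, List.mem_cons]
  grind

/-- A vertex whose avoiding component attaches to `a` and `b` is adjacent to both. -/
theorem adj_of_attached (h : G.IsFourCycle a x b y) (hfree : ¬ HasMinor G (cycleGraph 5))
    (hconn : ∀ v : α, (G.induce {w | w ≠ v}).Connected) {t' : α}
    (hst : G.ReachableAvoiding {a, x, b, y} s t) (hta : G.Adj t a)
    (hst' : G.ReachableAvoiding {a, x, b, y} s t') (htb : G.Adj t' b) :
    G.Adj s a ∧ G.Adj s b := by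
  obtain rfl := h.eq_of_adj_opposite hfree (hst.symm.trans hst') hta htb
  by_cases hne : s = t
  · subst hne
    exact ⟨hta, htb⟩
  obtain ⟨w, hw⟩ := exists_walk_notMem_support (hconn t) hne hta.ne'
  obtain ⟨r, c, hc, hr, -, hrc, hsr⟩ := w.exists_first_mem hst.notMem_left (by simp)
  have hrt : r ≠ t := by rintro rfl; exact hw hr
  have htr := hst.symm.trans hsr
  simp only [Set.mem_insert_iff, Set.mem_singleton_iff] at hc
  have hset : ({b, y, a, x} : Set α) = {a, x, b, y} := by ext; simp; tauto
  rcases hc with rfl | rfl | rfl | rfl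
  · exact absurd (h.eq_of_adj_opposite hfree htr.symm hrc htb) hrt
  · exact absurd hrc (h.not_adj_consecutive hfree htr hta)
  · exact absurd (h.eq_of_adj_opposite hfree htr hta hrc).symm hrt
  · exact absurd hrc (h.rotate.rotate.not_adj_consecutive hfree (hset ▸ htr) htb)

theorem adj_opposite (h : G.IsFourCycle a x b y) (hfree : ¬ HasMinor G (cycleGraph 5))
    (hconn : ∀ v : α, (G.induce {w | w ≠ v}).Connected) (hs : s ∉ ({a, x, b, y} : Set α)) :
    (G.Adj s a ∧ G.Adj s b) ∨ (G.Adj s x ∧ G.Adj s y) := by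
  let C : Set α := {a, x, b, y}
  let A : α → Prop := fun c => ∃ t, G.ReachableAvoiding C s t ∧ G.Adj t c
  have key : ∀ d ∈ C, ∀ v ∈ C, d ≠ v → ∃ c ∈ C, c ≠ v ∧ A c := by
    intro d hd v hv hdv
    obtain ⟨w, hw⟩ := exists_walk_notMem_support (hconn v) (ne_of_mem_of_not_mem hv hs).symm hdv
    obtain ⟨t, c, hc, -, hcw, htc, hst⟩ := w.exists_first_mem hs hd
    exact ⟨c, hc, by rintro rfl; exact hw hcw, t, hst, htc⟩
  have hC₁ : C = {x, b, y, a} := by ext; simp [C]; tauto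
  have hC₂ : C = {b, y, a, x} := by ext; simp [C]; tauto
  have hC₃ : C = {y, a, x, b} := by ext; simp [C]; tauto
  have n₀ : ¬ (A a ∧ A x) := fun ⟨⟨_, h₁, h₂⟩, _, h₃, h₄⟩ =>
    h.not_adj_consecutive hfree (h₁.symm.trans h₃) h₂ h₄
  have n₁ : ¬ (A x ∧ A b) := fun ⟨⟨_, h₁, h₂⟩, _, h₃, h₄⟩ =>
    h.rotate.not_adj_consecutive hfree (hC₁ ▸ h₁.symm.trans h₃) h₂ h₄
  have n₂ : ¬ (A b ∧ A y) := fun ⟨⟨_, h₁, h₂⟩, _, h₃, h₄⟩ =>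
    h.rotate.rotate.not_adj_consecutive hfree (hC₂ ▸ h₁.symm.trans h₃) h₂ h₄
  have n₃ : ¬ (A y ∧ A a) := fun ⟨⟨_, h₁, h₂⟩, _, h₃, h₄⟩ =>
    h.rotate.rotate.rotate.not_adj_consecutive hfree (hC₃ ▸ h₁.symm.trans h₃) h₂ h₄
  have ka := key x (by simp [C]) a (by simp [C]) h.adj₁.ne'
  have kx := key a (by simp [C]) x (by simp [C]) h.adj₁.ne
  have kb := key a (by simp [C]) b (by simp [C]) h.ne₁
  have ky := key a (by simp [C]) y (by simp [C]) h.adj₄.ne'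
  have hA : (A a ∧ A b) ∨ (A x ∧ A y) := by
    clear_value A
    simp only [C, Set.mem_insert_iff, Set.mem_singleton_iff, exists_eq_or_imp,
      exists_eq_left] at ka kx kb ky
    clear key hC₁ hC₂ hC₃
    grind
  rcases hA with ⟨⟨t, hst, hta⟩, t', hst', htb⟩ | ⟨⟨t, hst, hta⟩, t', hst', htb⟩
  · exact .inl (h.adj_of_attached hfree hconn hst hta hst' htb)
  · exact .inr (h.rotate.adj_of_attached hfree hconn (hC₁ ▸ hst) hta (hC₁ ▸ hst') htb)

theorem adj_both (h : G.IsFourCycle a x b y) (hfree : ¬ HasMinor G (cycleGraph 5))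
    (hconn : ∀ v : α, (G.induce {w | w ≠ v}).Connected) (hs : s ∉ ({a, x, b, y} : Set α))
    (hsa : G.Adj s a) (hsb : G.Adj s b) (v : α) (hva : v ≠ a) (hvb : v ≠ b) :
    G.Adj v a ∧ G.Adj v b := by
  by_cases hv : v ∈ ({a, x, b, y} : Set α)
  · simp only [Set.mem_insert_iff, Set.mem_singleton_iff, hva, hvb, false_or] at hv
    rcases hv with rfl | rfl
    · exact ⟨h.adj₁.symm, h.adj₂⟩
    · exact ⟨h.adj₄, h.adj₃.symm⟩
  · refine (h.adj_opposite hfree hconn hv).resolve_right fun ⟨hvx, hvy⟩ => hfree ?_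
    refine hasMinor_cycleGraph_five_of_isPath
      (.cons hsa (.cons h.adj₁ (.cons hvx.symm (.cons hvy (.cons h.adj₃.symm .nil))))) ?_
      (by simp) hsb
    have := h.adj₁.ne; have := h.adj₂.ne; have := h.adj₃.ne; have := h.adj₄.ne
    have := h.ne₁; have := h.ne₂
    have hsv : s ≠ v := by
      rintro rfl
      exact h.not_adj_consecutive hfree ⟨.nil, by simpa using hs⟩ hsa hvx
    simp only [Set.mem_insert_iff, Set.mem_singleton_iff, not_or] at hs hv
    simp only [Walk.cons_isPath_iff, Walk.support_cons, List.mem_cons, Walk.support_nil,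
      Walk.IsPath.nil]
    grind

end IsFourCycle

theorem exists_isFourCycle {G : SimpleGraph α} [Fintype α] (hcard : 4 ≤ Fintype.card α)
    (hG : G.Connected) (hconn : ∀ v : α, (G.induce {w | w ≠ v}).Connected)
    (hfree : ¬ HasMinor G (cycleGraph 5)) : ∃ a x b y, G.IsFourCycle a x b y := by
  by_contra! hno
  have htrans : ∀ u w v, G.Adj u w → G.Adj w v → u ≠ v → G.Adj u v := by
    intro u w v huw hwv huv
    by_contra hnadj
    obtain ⟨q, hq⟩ := exists_walk_notMem_support (hconn w) huw.ne hwv.ne'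
    obtain ⟨p, hp, hpw⟩ := ReachableAvoiding.exists_isPath (C := {w})
      ⟨q, fun z hz => by rintro rfl; exact hq hz⟩
    have hw : w ∉ p.support := fun hw => hpw w hw rfl
    by_cases hl : 3 ≤ p.length
    · exact hfree (hasMinor_cycleGraph_five_of_isPath (.cons huw.symm p)
        ((Walk.cons_isPath_iff _ _).2 ⟨hp, hw⟩) (by simpa using hl) hwv)
    · match p, hl with
      | .nil, _ => exact huv rfl
      | .cons h .nil, _ => exact hnadj h
      | .cons (v := r) h₁ (.cons h₂ .nil), _ =>
        refine hno u w v r ⟨huw, hwv, h₂.symm, h₁.symm, huv, ?_⟩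
        rintro rfl
        simp at hw
      | .cons _ (.cons _ (.cons _ _)), hl => simp at hl
  have hcomplete : ∀ u v, u ≠ v → G.Adj u v := by
    intro u v
    obtain ⟨p⟩ := hG.preconnected u v
    induction p with
    | nil => exact fun h => absurd rfl h
    | @cons u r v h p ih =>
      intro huv
      by_cases hrv : r = v
      · exact hrv ▸ h
      · exact htrans u r v h (ih hrv) huv
  obtain ⟨f⟩ : Nonempty (Fin 4 ↪ α) :=
    Function.Embedding.nonempty_of_card_le (by simpa using hcard)
  have hf : ∀ i j, i ≠ j → f i ≠ f j := fun i j h => f.injective.ne h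
  exact hno (f 0) (f 1) (f 2) (f 3) ⟨hcomplete _ _ (hf _ _ (by decide)),
    hcomplete _ _ (hf _ _ (by decide)), hcomplete _ _ (hf _ _ (by decide)),
    hcomplete _ _ (hf _ _ (by decide)), hf _ _ (by decide), hf _ _ (by decide)⟩

theorem iso_of_adj_both {G : SimpleGraph α} [Fintype α] {a b : α} (hab : a ≠ b)
    (hadj : ∀ v, v ≠ a → v ≠ b → G.Adj v a ∧ G.Adj v b)
    (hind : ∀ v w, v ≠ a → v ≠ b → w ≠ a → w ≠ b → ¬ G.Adj v w) :
    (∃ p : ℕ, Nonempty (G ≃g completeBipartiteGraph (Fin 2) (Fin p))) ∨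
    (∃ p : ℕ, Nonempty (G ≃g K2pPlusEdge p)) := by
  classical
  let e := (Fintype.equivFin {v : α // v ≠ a ∧ v ≠ b}).symm
  set p := Fintype.card {v : α // v ≠ a ∧ v ≠ b}
  let f : Fin 2 ⊕ Fin p → α := Sum.elim ![a, b] fun i => (e i).1
  have hea : ∀ i, (e i).1 ≠ a := fun i => (e i).2.1
  have heb : ∀ i, (e i).1 ≠ b := fun i => (e i).2.2
  have hf : Function.Bijective f := by
    constructor
    · rintro (i | i) (j | j) hij
      · fin_cases i <;> fin_cases j <;> simp_all [f]
      · fin_cases i <;> simp [f] at hij <;> grind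
      · fin_cases j <;> simp [f] at hij <;> grind
      · simpa [f, Subtype.val_inj] using hij
    · intro v
      by_cases hva : v = a
      · exact ⟨.inl 0, by simp [f, hva]⟩
      by_cases hvb : v = b
      · exact ⟨.inl 1, by simp [f, hvb]⟩
      exact ⟨.inr (e.symm ⟨v, hva, hvb⟩), by simp [f]⟩
  have h₁ : ∀ i, G.Adj a (e i).1 := fun i => (hadj _ (hea i) (heb i)).1.symm
  have h₂ : ∀ i, G.Adj b (e i).1 := fun i => (hadj _ (hea i) (heb i)).2.symm
  have h₃ : ∀ i j, ¬ G.Adj (e i).1 (e j).1 := fun i j =>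
    hind _ _ (hea i) (heb i) (hea j) (heb j)
  by_cases hE : G.Adj a b
  · refine .inr ⟨p, ⟨(RelIso.mk (Equiv.ofBijective f hf) ?_).symm⟩⟩
    rintro (i | i) (j | j)
    · fin_cases i <;> fin_cases j <;> simp [f, K2pPlusEdge, hE, hE.symm]
    · fin_cases i <;> simp [f, K2pPlusEdge, h₁, h₂]
    · fin_cases j <;> simp [f, K2pPlusEdge, (h₁ _).symm, (h₂ _).symm]
    · simp [f, K2pPlusEdge, h₃]
  · have hE' : ¬ G.Adj b a := fun h => hE h.symm
    refine .inl ⟨p, ⟨(RelIso.mk (Equiv.ofBijective f hf) ?_).symm⟩⟩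
    rintro (i | i) (j | j)
    · fin_cases i <;> fin_cases j <;> simp [f, hE, hE']
    · fin_cases i <;> simp [f, h₁, h₂]
    · fin_cases j <;> simp [f, (h₁ _).symm, (h₂ _).symm]
    · simp [f, h₃]

theorem iso_of_adj_both_of_five_le_card {G : SimpleGraph α} [Fintype α] {a b : α}
    (hcard : 5 ≤ Fintype.card α) (hab : a ≠ b) (hfree : ¬ HasMinor G (cycleGraph 5))
    (hadj : ∀ v, v ≠ a → v ≠ b → G.Adj v a ∧ G.Adj v b) :
    (∃ p : ℕ, Nonempty (G ≃g completeBipartiteGraph (Fin 2) (Fin p))) ∨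
    (∃ p : ℕ, Nonempty (G ≃g K2pPlusEdge p)) := by
  classical
  refine iso_of_adj_both hab hadj fun v w hva hvb hwa hwb hvw => hfree ?_
  obtain ⟨u, -, hu⟩ : ∃ u ∈ Finset.univ, u ∉ ({a, b, v, w} : Finset α) :=
    Finset.exists_mem_notMem_of_card_lt_card (Finset.card_le_four.trans_lt hcard)
  simp only [Finset.mem_insert, Finset.mem_singleton, not_or] at hu
  refine hasMinor_cycleGraph_five_of_isPath
    (.cons (hadj v hva hvb).1.symm (.cons hvw (.cons (hadj w hwa hwb).2
      (.cons (hadj u hu.1 hu.2.1).2.symm .nil)))) ?_ (by simp) (hadj u hu.1 hu.2.1).1.symm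
  have := hvw.ne
  simp only [Walk.cons_isPath_iff, Walk.support_cons, List.mem_cons, Walk.support_nil,
    Walk.IsPath.nil]
  grind

end SimpleGraph

/-- Every 2-connected `C₅`-minor-free graph has at most 4 vertices, or is isomorphic
to `K_{2,p}` for some `p`, or is isomorphic to `K'_{2,p}` for some `p`. -/
theorem twoConnected_c5_minor_free (G : SimpleGraph α) [Fintype α]
    (h2 : TwoConnected G) (hfree : ¬ HasMinor G (cycleGraph 5)) :
    Fintype.card α ≤ 4 ∨
    (∃ p : ℕ, Nonempty (G ≃g completeBipartiteGraph (Fin 2) (Fin p))) ∨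
    (∃ p : ℕ, Nonempty (G ≃g K2pPlusEdge p)) := by
  classical
  obtain ⟨-, hG, hconn⟩ := h2
  refine or_iff_not_imp_left.2 fun hcard => ?_
  have hcard : 5 ≤ Fintype.card α := by omega
  obtain ⟨a, x, b, y, h⟩ := exists_isFourCycle (by omega) hG hconn hfree
  obtain ⟨s, -, hs⟩ : ∃ s ∈ Finset.univ, s ∉ ({a, x, b, y} : Finset α) :=
    Finset.exists_mem_notMem_of_card_lt_card (Finset.card_le_four.trans_lt hcard)
  have hs : s ∉ ({a, x, b, y} : Set α) := by simpa using hs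
  rcases h.adj_opposite hfree hconn hs with ⟨h₁, h₂⟩ | ⟨h₁, h₂⟩
  · exact iso_of_adj_both_of_five_le_card hcard h.ne₁ hfree (h.adj_both hfree hconn hs h₁ h₂)
  · have hset : ({x, b, y, a} : Set α) = {a, x, b, y} := by ext; simp; tauto
    exact iso_of_adj_both_of_five_le_card hcard h.ne₂ hfree
      (h.rotate.adj_both hfree hconn (hset ▸ hs) h₁ h₂)
end

section
/- Let G be a connected K_4-minimal graph. Suppose G contains two vertex-disjoint cycles C_1 and C_2, and three edges a_1b_1, a_2b_2, a_3b_3 of G that are pairwise vertex-disjoint, with a_i a vertex of C_1 and b_i not a vertex of C_1 for each i. Then G consists of two vertex-disjoint triangles x_1x_2x_3 and y_1y_2y_3 together with three paths P_1, P_2, P_3, where P_i joins x_i to y_i, the paths are pairwise vertex-disjoint, each path is internally disjoint from both triangles, and every vertex of G lies on one of the triangles or paths. -/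
open SimpleGraph

variable {α β : Type*}

/-- `G` consists of two vertex-disjoint triangles `x 0, x 1, x 2` and `y 0, y 1, y 2`
together with three pairwise vertex-disjoint paths, the `i`-th joining `x i` to `y i`,
each internally disjoint from both triangles, every vertex of `G` lying on one of the
triangles or paths, and every edge of `G` being a triangle edge or a path edge. -/
def TwoTrianglesThreePaths (G : SimpleGraph α) : Prop :=
  ∃ x y : Fin 3 → α,
    (∀ i j, i ≠ j → G.Adj (x i) (x j)) ∧
    (∀ i j, i ≠ j → G.Adj (y i) (y j)) ∧
    (∀ i j, x i ≠ y j) ∧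
    ∃ P : (i : Fin 3) → G.Walk (x i) (y i),
      (∀ i, (P i).IsPath) ∧
      (∀ i j, i ≠ j → ∀ z, z ∈ (P i).support → z ∉ (P j).support) ∧
      (∀ i j z, z ∈ (P i).support → (z = x j ∨ z = y j) → (z = x i ∨ z = y i)) ∧
      (∀ z : α, ∃ i, z ∈ (P i).support) ∧
      (∀ z w, G.Adj z w →
        (∃ i j, i ≠ j ∧ ((z = x i ∧ w = x j) ∨ (z = y i ∧ w = y j))) ∨
        ∃ i, s(z, w) ∈ (P i).edges)

/-- `ReachIn G t x y` says that `G` has a walk from `x` to `y` inside the set `t`. -/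
def ReachIn (G : SimpleGraph α) (t : Set α) (x y : α) : Prop :=
  ∃ p : G.Walk x y, ∀ z ∈ p.support, z ∈ t

namespace ReachIn

variable {G : SimpleGraph α} {s t : Set α} {x y z : α}

lemma refl (hx : x ∈ t) : ReachIn G t x x := ⟨.nil, by simpa⟩

lemma symm (h : ReachIn G t x y) : ReachIn G t y x := by
  obtain ⟨p, hp⟩ := h
  exact ⟨p.reverse, by simpa using hp⟩

lemma trans (h : ReachIn G t x y) (h' : ReachIn G t y z) : ReachIn G t x z := by
  obtain ⟨p, hp⟩ := h
  obtain ⟨q, hq⟩ := h'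
  refine ⟨p.append q, fun w hw => ?_⟩
  rw [Walk.mem_support_append_iff] at hw
  exact hw.elim (hp w) (hq w)

lemma of_adj (hx : x ∈ t) (hy : y ∈ t) (h : G.Adj x y) : ReachIn G t x y :=
  ⟨h.toWalk, by simp [hx, hy]⟩

lemma mono (hst : s ⊆ t) (h : ReachIn G s x y) : ReachIn G t x y := by
  obtain ⟨p, hp⟩ := h
  exact ⟨p, fun z hz => hst (hp z hz)⟩

lemma map_of_adj {f : α → α} (hf : ∀ x ∈ s, ReachIn G t (f x) (f x))
    (hadj : ∀ x ∈ s, ∀ y ∈ s, G.Adj x y → ReachIn G t (f x) (f y))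
    (h : ReachIn G s x y) : ReachIn G t (f x) (f y) := by
  obtain ⟨p, hp⟩ := h
  induction p with
  | nil => exact hf _ (hp _ (by simp))
  | cons h p ih =>
    exact (hadj _ (hp _ (by simp)) _ (hp _ (by simp)) h).trans
      (ih fun z hz => hp z (by simp [hz]))

end ReachIn

lemma induce_connected_iff_reachIn {G : SimpleGraph α} {s : Set α} :
    (G.induce s).Connected ↔ s.Nonempty ∧ ∀ x ∈ s, ∀ y ∈ s, ReachIn G s x y := by
  constructor
  · intro h
    refine ⟨Set.nonempty_coe_sort.mp h.nonempty, fun x hx y hy => ?_⟩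
    obtain ⟨p⟩ := h.preconnected ⟨x, hx⟩ ⟨y, hy⟩
    refine ⟨p.map (Embedding.induce s).toHom, fun z hz => ?_⟩
    have hz' : z ∈ (p.map (Embedding.induce s).toHom).support := hz
    rw [Walk.support_map, List.mem_map] at hz'
    obtain ⟨w, -, rfl⟩ := hz'
    exact w.2
  · rintro ⟨⟨u, hu⟩, h⟩
    rw [connected_iff_exists_forall_reachable]
    refine ⟨⟨u, hu⟩, fun ⟨y, hy⟩ => ?_⟩
    obtain ⟨p, hp⟩ := h u hu y hy
    exact ⟨p.induce s hp⟩

lemma induce_connected_of_reachIn {G : SimpleGraph α} {s : Set α} {u : α} (hu : u ∈ s)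
    (h : ∀ x ∈ s, ReachIn G s u x) : (G.induce s).Connected :=
  induce_connected_iff_reachIn.mpr
    ⟨⟨u, hu⟩, fun x hx y hy => (h x hx).symm.trans (h y hy)⟩

lemma reachIn_of_connected {G : SimpleGraph α} {s t : Set α} {x y : α}
    (h : (G.induce s).Connected) (hst : s ⊆ t) (hx : x ∈ s) (hy : y ∈ s) : ReachIn G t x y :=
  ((induce_connected_iff_reachIn.mp h).2 x hx y hy).mono hst

lemma induce_connected_singleton (G : SimpleGraph α) (x : α) : (G.induce {x}).Connected :=
  induce_connected_of_reachIn (u := x) rfl fun y hy => by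
    obtain rfl : y = x := hy
    exact ReachIn.refl rfl

lemma induce_connected_insert {G : SimpleGraph α} {s : Set α} {x y : α}
    (hs : (G.induce s).Connected) (hy : y ∈ s) (hxy : G.Adj x y) :
    (G.induce (insert x s)).Connected := by
  rw [← Set.singleton_union]
  exact connected_induce_union (induce_connected_singleton G x).preconnected hs.preconnected
    rfl hy hxy

lemma induce_connected_image_val {G : SimpleGraph α} {D : Set α} {s : Set D} :
    ((G.induce D).induce s).Connected ↔ (G.induce (Subtype.val '' s)).Connected := by
  exact Iso.connected_iff ⟨Equiv.Set.image _ s Subtype.val_injective, Iff.rfl⟩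

lemma IsMinorModel.exists_mem_of_minorMinimal {G : SimpleGraph α} {H : SimpleGraph β}
    (hmin : MinorMinimal G H) {V : β → Set α} (hV : IsMinorModel G H V) (x : α) :
    ∃ i, x ∈ V i := by
  by_contra! hx
  obtain ⟨h1, h2, h3, h4⟩ := hV
  have hval : ∀ i, Subtype.val '' (Subtype.val ⁻¹' V i : Set {y | y ≠ x}) = V i := fun i => by
    rw [Subtype.image_preimage_coe]
    exact Set.inter_eq_right.mpr fun y hy hyx => hx i (hyx ▸ hy)
  have hne : ∀ i, ∀ y ∈ V i, y ≠ x := fun i y hy hyx => hx i (hyx ▸ hy)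
  refine hmin.2 x ⟨fun i => Subtype.val ⁻¹' V i, fun i => ?_, fun i j hij => ?_, fun i => ?_,
    fun i j hij => ?_⟩
  · obtain ⟨y, hy⟩ := h1 i
    exact ⟨⟨y, hne i y hy⟩, hy⟩
  · exact (h2 hij).preimage _
  · rw [induce_connected_image_val, hval]
    exact h3 i
  · obtain ⟨y, hy, z, hz, hyz⟩ := h4 i j hij
    exact ⟨⟨y, hne i y hy⟩, hy, ⟨z, hne j z hz⟩, hz, hyz⟩

/-- Three pairwise adjacent disjoint connected sets, together with a connected set attached to
all of them, cover a `K₄`-minimal graph. -/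
lemma mem_of_wheel_of_minorMinimal {G : SimpleGraph α}
    (hmin : MinorMinimal G (⊤ : SimpleGraph (Fin 4))) {A : Fin 3 → Set α} {D : Set α}
    (hA : ∀ i, (G.induce (A i)).Connected) (hAA : ∀ i j, i ≠ j → Disjoint (A i) (A j))
    (hadj : ∀ i j, i ≠ j → ∃ x ∈ A i, ∃ y ∈ A j, G.Adj x y)
    (hD : (G.induce D).Connected) (hAD : ∀ i, Disjoint (A i) D)
    (hatt : ∀ i, ∃ x ∈ A i, ∃ y ∈ D, G.Adj x y) (x : α) (hx : ∀ i, x ∉ A i) : x ∈ D := by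
  have hV : IsMinorModel G (⊤ : SimpleGraph (Fin 4)) (Fin.cons D A) := by
    refine ⟨?_, ?_, ?_, ?_⟩
    · refine Fin.cases ?_ fun i => ?_
      · exact Set.nonempty_coe_sort.mp hD.nonempty
      · exact Set.nonempty_coe_sort.mp (hA i).nonempty
    · refine Fin.cases (Fin.cases (by simp) fun j _ => ?_) fun i => Fin.cases (fun _ => ?_)
        fun j hij => ?_
      · exact (hAD j).symm
      · exact hAD i
      · exact hAA i j (by simpa using hij)
    · exact Fin.cases hD hA
    · refine Fin.cases (Fin.cases (by simp) fun j _ => ?_) fun i => Fin.cases (fun _ => ?_)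
        fun j hij => ?_
      · obtain ⟨x, hx, y, hy, h⟩ := hatt j
        exact ⟨y, hy, x, hx, h.symm⟩
      · exact hatt i
      · exact hadj i j (by simpa using hij)
  obtain ⟨i, hi⟩ := hV.exists_mem_of_minorMinimal hmin x
  induction i using Fin.cases with
  | zero => exact hi
  | succ i => exact absurd hi (hx i)

/-- A `K₄`-model with no branch set inside `D`, where `D` is separated from the rest by
`{u, v}`, allows `D` to be replaced by the interior of a single `u`-`v` path. -/
lemma false_of_two_separation {G : SimpleGraph α} {H : SimpleGraph β}
    (hmin : MinorMinimal G H) {V : β → Set α} (hV : IsMinorModel G H V)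
    {D Q : Set α} {u v : α} (hu : u ∉ D) (hv : v ∉ D)
    (hsep : ∀ x ∈ D, ∀ y ∉ D, G.Adj x y → y = u ∨ y = v)
    (hVD : ∀ i, ¬ V i ⊆ D) (hQ : (G.induce Q).Connected) (huQ : u ∈ Q)
    (hQv : v = u ∨ ∃ q ∈ Q, G.Adj q v) (hQD : ∀ q ∈ Q, q = u ∨ q ∈ D)
    {w : α} (hwD : w ∈ D) (hwQ : w ∉ Q) : False := by
  classical
  obtain ⟨h1, h2, h3, h4⟩ := hV
  have hV' : ∀ i x, x ∈ V i → x ∈ D → u ∈ V i ∨ v ∈ V i := by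
    intro i x hx hxD
    by_contra! hno
    obtain ⟨y, hy, hyD⟩ := Set.not_subset.mp (hVD i)
    have := reachIn_of_connected (h3 i) subset_rfl hx hy
    obtain ⟨p, hp⟩ := this
    obtain ⟨d, hd, hd1, hd2⟩ := p.exists_boundary_dart D hxD hyD
    rcases hsep _ hd1 _ hd2 d.adj with h | h
    · exact hno.1 (h ▸ hp _ (p.dart_snd_mem_support_of_mem_darts hd))
    · exact hno.2 (h ▸ hp _ (p.dart_snd_mem_support_of_mem_darts hd))
  have huniq : ∀ i j x, x ∈ V i → x ∈ V j → i = j := fun i j x hi hj => by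
    by_contra hij
    exact Set.disjoint_left.mp (h2 hij) hi hj
  let W : β → Set α := fun i => (V i \ D) ∪ {q | q ∈ Q ∧ u ∈ V i}
  have hWV : ∀ i x, x ∈ V i → x ∉ D → x ∈ W i := fun i x h h' => Or.inl ⟨h, h'⟩
  have hWQ : ∀ i, u ∈ V i → Q ⊆ W i := fun i h q hq => Or.inr ⟨hq, h⟩
  have hW : IsMinorModel G H W := by
    refine ⟨fun i => ?_, fun i j hij => ?_, fun i => ?_, fun i j hij => ?_⟩
    · obtain ⟨y, hy, hyD⟩ := Set.not_subset.mp (hVD i)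
      exact ⟨y, hWV i y hy hyD⟩
    · refine Set.disjoint_left.mpr ?_
      rintro x (⟨hx, hxD⟩ | ⟨hx, hxu⟩) (⟨hy, hyD⟩ | ⟨hy, hyu⟩)
      · exact hij (huniq i j x hx hy)
      · rcases hQD x hy with rfl | h
        · exact hij (huniq i j _ hx hyu)
        · exact hxD h
      · rcases hQD x hx with rfl | h
        · exact hij (huniq i j _ hxu hy)
        · exact hyD h
      · exact hij (huniq i j u hxu hyu)
    · obtain ⟨y, hy, hyD⟩ := Set.not_subset.mp (hVD i)
      have key : ∀ c ∈ W i, (∀ x ∈ V i, ∀ z ∈ V i, x ∈ D → z ∉ D → G.Adj x z → ReachIn G (W i) c z) →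
          (u ∈ V i → c = u) → (G.induce (W i)).Connected := by
        intro c hc hcz hcu
        let f : α → α := fun x => if x ∈ D then c else x
        have hf : ∀ x ∈ V i, f x ∈ W i := fun x hx => by
          by_cases h : x ∈ D
          · simpa [f, h]
          · simpa [f, h] using hWV i x hx h
        have hfy : f y = y := by simp [f, hyD]
        have hreach : ∀ x ∈ V i, ReachIn G (W i) y (f x) := fun x hx => by
          have := ReachIn.map_of_adj (f := f) (s := V i) (t := W i)
            (fun x hx => ReachIn.refl (hf x hx)) ?_ (reachIn_of_connected (h3 i) subset_rfl hy hx)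
          · rwa [hfy] at this
          · intro a ha b hb hab
            by_cases haD : a ∈ D <;> by_cases hbD : b ∈ D
            · simpa [f, haD, hbD] using ReachIn.refl hc
            · simpa [f, haD, hbD] using hcz a ha b hb haD hbD hab
            · simpa [f, haD, hbD] using (hcz b hb a ha hbD haD hab.symm).symm
            · simpa [f, haD, hbD] using
                ReachIn.of_adj (hWV i a ha haD) (hWV i b hb hbD) hab
        refine induce_connected_of_reachIn (hWV i y hy hyD) ?_
        rintro x (⟨hx, hxD⟩ | ⟨hx, hxu⟩)
        · simpa [f, hxD] using hreach x hx
        · have h := hreach u hxu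
          simp only [f, hu, if_false] at h
          exact h.trans (reachIn_of_connected hQ (hWQ i hxu) huQ hx)
      by_cases hui : u ∈ V i
      · refine key u (hWV i u hui hu) ?_ fun _ => rfl
        intro x hx z hz hxD hzD hxz
        rcases hsep x hxD z hzD hxz with rfl | rfl
        · exact ReachIn.refl (hWV i _ hui hu)
        · rcases hQv with rfl | ⟨q, hq, hqv⟩
          · exact ReachIn.refl (hWV i _ hui hu)
          · exact (reachIn_of_connected hQ (hWQ i hui) huQ hq).trans
              (ReachIn.of_adj (hWQ i hui hq) (hWV i _ hz hzD) hqv)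
      · by_cases hvi : v ∈ V i
        · refine key v (hWV i v hvi hv) ?_ fun h => absurd h hui
          intro x hx z hz hxD hzD hxz
          rcases hsep x hxD z hzD hxz with rfl | rfl
          · exact absurd hz hui
          · exact ReachIn.refl (hWV i _ hvi hv)
        · refine key y (hWV i y hy hyD) ?_ fun h => absurd h hui
          intro x hx z hz hxD hzD hxz
          exact absurd (hV' i x hx hxD) (by tauto)
    · have hne : i ≠ j := hij.ne
      have cross : ∀ i j, i ≠ j → u ∈ V i → v ∈ V j → ∃ x ∈ W i, ∃ y ∈ W j, G.Adj x y := by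
        intro i j hij hi hj
        rcases hQv with rfl | ⟨q, hq, hqv⟩
        · exact absurd (huniq i j _ hi hj) hij
        · exact ⟨q, hWQ i hi hq, v, hWV j v hj hv, hqv⟩
      have cross' : (u ∈ V i ∧ v ∈ V j) ∨ (u ∈ V j ∧ v ∈ V i) →
          ∃ x ∈ W i, ∃ y ∈ W j, G.Adj x y := by
        rintro (⟨h, h'⟩ | ⟨h, h'⟩)
        · exact cross i j hne h h'
        · obtain ⟨x, hx, y, hy, hxy⟩ := cross j i hne.symm h h'
          exact ⟨y, hy, x, hx, hxy.symm⟩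
      obtain ⟨x, hx, y, hy, hxy⟩ := h4 i j hij
      by_cases hxD : x ∈ D
      · apply cross'
        have hi := hV' i x hx hxD
        have hj : u ∈ V j ∨ v ∈ V j := by
          by_cases hyD : y ∈ D
          · exact hV' j y hy hyD
          · rcases hsep x hxD y hyD hxy with rfl | rfl
            · exact Or.inl hy
            · exact Or.inr hy
        have := huniq i j u
        have := huniq i j v
        tauto
      · by_cases hyD : y ∈ D
        · apply cross'
          have hj := hV' j y hy hyD
          have hi : u ∈ V i ∨ v ∈ V i := by
            rcases hsep y hyD x hxD hxy.symm with rfl | rfl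
            · exact Or.inl hx
            · exact Or.inr hx
          have := huniq i j u
          have := huniq i j v
          tauto
        · exact ⟨x, hWV i x hx hxD, y, hWV j y hy hyD, hxy⟩
  obtain ⟨i, hi⟩ := hW.exists_mem_of_minorMinimal hmin w
  rcases hi with ⟨-, h⟩ | ⟨h, -⟩
  · exact h hwD
  · exact hwQ h

/-- Adjacency of vertices on a geodesic, and their position, is determined by the distance to
the start. -/
lemma getVert_dist_of_length_eq_dist {G : SimpleGraph α} {u v x : α} {p : G.Walk u v}
    (hp : p.length = G.dist u v) (hx : x ∈ p.support) :
    G.dist u x ≤ p.length ∧ p.getVert (G.dist u x) = x := by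
  obtain ⟨n, rfl, hn⟩ := Walk.mem_support_iff_exists_getVert.mp hx
  have h := length_eq_dist_of_subwalk hp (p.isSubwalk_take n)
  rw [Walk.take_length, min_eq_left hn] at h
  rw [← h]
  exact ⟨hn, rfl⟩

lemma dist_getVert_of_length_eq_dist {G : SimpleGraph α} {u v : α} {p : G.Walk u v}
    (hp : p.length = G.dist u v) {n : ℕ} (hn : n ≤ p.length) : G.dist u (p.getVert n) = n := by
  have h := length_eq_dist_of_subwalk hp (p.isSubwalk_take n)
  rw [Walk.take_length, min_eq_left hn] at h
  exact h.symm

lemma mem_edges_getVert {G : SimpleGraph α} {u v : α} (p : G.Walk u v) {n : ℕ}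
    (hn : n < p.length) : s(p.getVert n, p.getVert (n + 1)) ∈ p.edges := by
  rw [← Walk.mem_edges_toSubgraph]
  exact p.toSubgraph_adj_getVert hn

/-- Geodesics are induced paths. -/
lemma mem_edges_of_length_eq_dist {G : SimpleGraph α} {u v x y : α} {p : G.Walk u v}
    (hp : p.length = G.dist u v) (hx : x ∈ p.support) (hy : y ∈ p.support) (hxy : G.Adj x y) :
    s(x, y) ∈ p.edges := by
  have hx' := getVert_dist_of_length_eq_dist hp hx
  have hy' := getVert_dist_of_length_eq_dist hp hy
  have h1 := hxy.diff_dist_adj (u := u)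
  have h2 := hxy.symm.diff_dist_adj (u := u)
  have hne : G.dist u x ≠ G.dist u y := fun h => hxy.ne (by rw [← hx'.2, h, hy'.2])
  have : G.dist u y = G.dist u x + 1 ∨ G.dist u x = G.dist u y + 1 := by omega
  rcases this with h | h
  · have := mem_edges_getVert p (n := G.dist u x) (by omega)
    rwa [← h, hx'.2, hy'.2] at this
  · have := mem_edges_getVert p (n := G.dist u y) (by omega)
    rw [← h, hx'.2, hy'.2] at this
    rwa [Sym2.eq_swap]

/-- A graph with a vertex ordering in which every vertex has at most one earlier neighbour
has no nonempty finite set inducing minimum degree two. -/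
lemma false_of_height {G : SimpleGraph α} {Z : Set α} (hZ : Z.Finite) (hne : Z.Nonempty)
    (hdeg : ∀ x ∈ Z, ∃ y ∈ Z, ∃ z ∈ Z, y ≠ z ∧ G.Adj x y ∧ G.Adj x z) (h : α → ℕ)
    (hh : ∀ x y z, G.Adj x y → G.Adj x z → h y ≤ h x → h z ≤ h x → y = z) : False := by
  obtain ⟨x, hx, hmax⟩ := Set.exists_max_image Z h hZ hne
  obtain ⟨y, hy, z, hz, hyz, hxy, hxz⟩ := hdeg x hx
  exact hyz (hh x y z hxy hxz (hmax y hy) (hmax z hz))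

lemma false_of_forall_mem_geodesic {G : SimpleGraph α} {Z : Set α} (hZ : Z.Finite)
    (hne : Z.Nonempty) (hdeg : ∀ x ∈ Z, ∃ y ∈ Z, ∃ z ∈ Z, y ≠ z ∧ G.Adj x y ∧ G.Adj x z)
    {u v : α} {p : G.Walk u v} (hp : p.length = G.dist u v) (hall : ∀ x, x ∈ p.support) :
    False := by
  have hinj : ∀ x y, G.dist u x = G.dist u y → x = y := fun x y h => by
    rw [← (getVert_dist_of_length_eq_dist hp (hall x)).2, h,
      (getVert_dist_of_length_eq_dist hp (hall y)).2]
  refine false_of_height hZ hne hdeg (G.dist u) fun x y z hxy hxz hy hz => hinj y z ?_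
  have h1 := hxy.symm.diff_dist_adj (u := u)
  have h2 := hxz.symm.diff_dist_adj (u := u)
  have h3 : G.dist u x ≠ G.dist u y := fun h => hxy.ne (hinj _ _ h)
  have h4 : G.dist u x ≠ G.dist u z := fun h => hxz.ne (hinj _ _ h)
  omega

/-- A triangle `y 0, y 1, y 2` with three disjoint paths from `y i` to `b i`, spanning the
vertex set `D` and containing all edges inside `D`. -/
structure IsNet (G : SimpleGraph α) (D : Set α) (b y : Fin 3 → α)
    (S : ∀ i, G.Walk (y i) (b i)) : Prop where
  adj : ∀ i j, i ≠ j → G.Adj (y i) (y j)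
  isPath : ∀ i, (S i).IsPath
  disjoint : ∀ i j z, z ∈ (S i).support → z ∈ (S j).support → i = j
  mem_iff : ∀ z, z ∈ D ↔ ∃ i, z ∈ (S i).support
  edge : ∀ z ∈ D, ∀ w ∈ D, G.Adj z w →
    (∃ i j, i ≠ j ∧ z = y i ∧ w = y j) ∨ ∃ i, s(z, w) ∈ (S i).edges

/-- A connected graph with a cycle that is minimally connected subject to containing three
terminals is a triangle with three disjoint paths to the terminals. -/
lemma exists_isNet_univ {G : SimpleGraph α} (hG : G.Connected) (b : Fin 3 → α)
    (hmin : ∀ D : Set α, (G.induce D).Connected → (∀ i, b i ∈ D) → ∀ x, x ∈ D)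
    {Z : Set α} (hZ : Z.Finite) (hne : Z.Nonempty)
    (hdeg : ∀ x ∈ Z, ∃ y ∈ Z, ∃ z ∈ Z, y ≠ z ∧ G.Adj x y ∧ G.Adj x z) :
    ∃ y S, IsNet G Set.univ b y S := by
  obtain ⟨P, hP⟩ := hG.exists_walk_length_eq_dist (b 0) (b 1)
  have hPc := P.connected_induce_support
  have hb2 : b 2 ∉ P.support := fun hb2 => by
    refine false_of_forall_mem_geodesic hZ hne hdeg hP fun x => hmin _ hPc (fun i => ?_) x
    fin_cases i
    · exact P.start_mem_support
    · exact P.end_mem_support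
    · exact hb2
  obtain ⟨w, hw, hwmin⟩ := Set.exists_min_image {x | x ∈ P.support} (G.dist (b 2))
    P.support.finite_toSet ⟨b 0, P.start_mem_support⟩
  obtain ⟨Q₀, hQ₀⟩ := hG.exists_walk_length_eq_dist (b 2) w
  have hQpos : 0 < Q₀.length := by
    rw [hQ₀]
    exact hG.pos_dist_of_ne fun h => hb2 (h ▸ hw)
  obtain ⟨q, Q, hQ, hQlen, hqw⟩ : ∃ q, ∃ Q : G.Walk (b 2) q, Q.length = G.dist (b 2) q ∧
      Q.length + 1 = Q₀.length ∧ G.Adj q w := by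
    refine ⟨_, Q₀.take (Q₀.length - 1),
      length_eq_dist_of_subwalk hQ₀ (Q₀.isSubwalk_take _), ?_, ?_⟩
    · rw [Walk.take_length]
      omega
    · have := Q₀.adj_getVert_succ (i := Q₀.length - 1) (by omega)
      rwa [Nat.sub_add_cancel hQpos, Walk.getVert_length] at this
  have hPdist : ∀ x ∈ P.support, Q.length + 1 ≤ G.dist (b 2) x := fun x hx => by
    rw [hQlen, hQ₀]
    exact hwmin x hx
  have hQg : ∀ x ∈ Q.support, G.dist (b 2) x ≤ Q.length ∧ Q.getVert (G.dist (b 2) x) = x :=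
    fun x hx => getVert_dist_of_length_eq_dist hQ hx
  have hPg : ∀ x ∈ P.support, G.dist (b 0) x ≤ P.length ∧ P.getVert (G.dist (b 0) x) = x :=
    fun x hx => getVert_dist_of_length_eq_dist hP hx
  have hPQ : ∀ x ∈ P.support, x ∉ Q.support := fun x hx hx' => by
    have := hPdist x hx
    have := (hQg x hx').1
    omega
  have hall : ∀ x, x ∈ P.support ∨ x ∈ Q.support := fun x => by
    refine hmin _ (connected_induce_union hPc.preconnected
      Q.connected_induce_support.preconnected hw Q.end_mem_support hqw.symm) (fun i => ?_) x
    fin_cases i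
    · exact Or.inl P.start_mem_support
    · exact Or.inl P.end_mem_support
    · exact Or.inr Q.start_mem_support
  have hQeq : ∀ x ∈ Q.support, Q.length ≤ G.dist (b 2) x → x = q := fun x hx h => by
    have h1 := hQg x hx
    rw [← h1.2, le_antisymm h1.1 h, Walk.getVert_length]
  have hcross : ∀ x ∈ Q.support, ∀ z ∈ P.support, G.Adj x z → x = q := fun x hx z hz hxz => by
    have h1 := hPdist z hz
    have h2 := hxz.diff_dist_adj (u := b 2)
    exact hQeq x hx (by omega)
  have hPinj : ∀ x ∈ P.support, ∀ y ∈ P.support, G.dist (b 0) x = G.dist (b 0) y → x = y :=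
    fun x hx y hy h => by rw [← (hPg x hx).2, h, (hPg y hy).2]
  have hQinj : ∀ x ∈ Q.support, ∀ y ∈ Q.support, G.dist (b 2) x = G.dist (b 2) y → x = y :=
    fun x hx y hy h => by rw [← (hQg x hx).2, h, (hQg y hy).2]
  have hqQ : q ∈ Q.support := Q.end_mem_support
  -- the last vertex of `Q` has two neighbours on `P`
  obtain ⟨w', hw', hqw', hww'⟩ : ∃ w' ∈ P.support, G.Adj q w' ∧ w' ≠ w := by
    by_contra! huniq
    classical
    refine false_of_height hZ hne hdeg (fun x => if x ∈ P.support then G.dist (b 0) x else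
      P.length + 1 + (Q.length - G.dist (b 2) x)) fun x y z hxy hxz => ?_
    have a1 := hxy.symm.diff_dist_adj (u := b 0)
    have a2 := hxz.symm.diff_dist_adj (u := b 0)
    have a3 := hxy.symm.diff_dist_adj (u := b 2)
    have a4 := hxz.symm.diff_dist_adj (u := b 2)
    have hxP := hPg x
    by_cases hx : x ∈ P.support
    · have aux : ∀ y, G.Adj x y → y ∉ P.support →
          ¬ P.length + 1 + (Q.length - G.dist (b 2) y) ≤ G.dist (b 0) x := fun y _ hy h => by
        have := (hPg x hx).1
        omega
      by_cases hy : y ∈ P.support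
      · by_cases hz : z ∈ P.support
        · simp only [hx, hy, hz, if_true]
          intro h1 h2
          have h3 : G.dist (b 0) x ≠ G.dist (b 0) y := fun h => hxy.ne (hPinj x hx y hy h)
          have h4 : G.dist (b 0) x ≠ G.dist (b 0) z := fun h => hxz.ne (hPinj x hx z hz h)
          exact hPinj y hy z hz (by omega)
        · simp only [hx, hz, if_true, if_false]
          intro _ h
          exact absurd h (aux z hxz hz)
      · simp only [hx, hy, if_true, if_false]
        intro h
        exact absurd h (aux y hxy hy)
    · have hxQ := (hall x).resolve_left hx
      have b1 := (hQg x hxQ).1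
      have aux : ∀ y, G.Adj x y → y ∉ P.support → P.length + 1 + (Q.length - G.dist (b 2) y) ≤
          P.length + 1 + (Q.length - G.dist (b 2) x) → G.dist (b 2) y = G.dist (b 2) x + 1 ∧
            y ∈ Q.support ∧ x ≠ q := by
        intro y hxy hy h
        have hyQ := (hall y).resolve_left hy
        have h1 : G.dist (b 2) x ≠ G.dist (b 2) y := fun h => hxy.ne (hQinj x hxQ y hyQ h)
        have h2 := hxy.diff_dist_adj (u := b 2)
        have h3 := (hQg y hyQ).1
        refine ⟨by omega, hyQ, ?_⟩
        rintro rfl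
        omega
      by_cases hy : y ∈ P.support
      · obtain rfl := hcross x hxQ y hy hxy
        by_cases hz : z ∈ P.support
        · intro _ _
          rw [huniq y hy hxy, huniq z hz hxz]
        · simp only [hx, hz, if_false]
          intro _ h
          exact absurd rfl (aux z hxz hz h).2.2
      · by_cases hz : z ∈ P.support
        · obtain rfl := hcross x hxQ z hz hxz
          simp only [hx, hy, if_false]
          intro h
          exact absurd rfl (aux y hxy hy h).2.2
        · simp only [hx, hy, hz, if_false]
          intro h1 h2
          obtain ⟨c1, c2, -⟩ := aux y hxy hy h1
          obtain ⟨d1, d2, -⟩ := aux z hxz hz h2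
          exact hQinj y c2 z d2 (by omega)
  -- any two neighbours of `q` on `P` are consecutive
  have hcons : ∀ x ∈ P.support, ∀ y ∈ P.support, G.Adj q x → G.Adj q y →
      ¬ G.dist (b 0) x + 1 < G.dist (b 0) y := by
    intro x hx y hy hqx hqy hlt
    have hyl := hPg y hy
    have hxl := hPg x hx
    have hc : (G.induce ({z | z ∈ (P.take (G.dist (b 0) x)).support} ∪
        ({z | z ∈ Q.support} ∪ {z | z ∈ (P.drop (G.dist (b 0) y)).support}))).Connected := by
      refine connected_induce_union (Walk.connected_induce_support _).preconnected
        (connected_induce_union (Walk.connected_induce_support _).preconnected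
          (Walk.connected_induce_support _).preconnected hqQ (Walk.start_mem_support _)
          ?_).preconnected (Walk.end_mem_support _) (Or.inl hqQ) ?_
      · rwa [hyl.2]
      · rw [hxl.2]
        exact hqx.symm
    have := hmin _ hc (fun i => ?_) (P.getVert (G.dist (b 0) x + 1))
    · have hd := dist_getVert_of_length_eq_dist hP (n := G.dist (b 0) x + 1) (by omega)
      rcases this with h | h | h
      · obtain ⟨n, hn, hn'⟩ := Walk.mem_support_iff_exists_getVert.mp h
        rw [Walk.take_getVert] at hn
        rw [← hn, dist_getVert_of_length_eq_dist hP (by omega)] at hd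
        omega
      · exact hPQ _ (P.getVert_mem_support _) h
      · obtain ⟨n, hn, hn'⟩ := Walk.mem_support_iff_exists_getVert.mp h
        rw [Walk.drop_getVert] at hn
        rw [Walk.drop_length] at hn'
        rw [← hn, dist_getVert_of_length_eq_dist hP (by omega)] at hd
        omega
    · fin_cases i
      · exact Or.inl (Walk.start_mem_support _)
      · exact Or.inr (Or.inr (Walk.end_mem_support _))
      · exact Or.inr (Or.inl Q.start_mem_support)
  obtain ⟨s, hs, hqs, hqs'⟩ : ∃ s, s + 1 ≤ P.length ∧ G.Adj q (P.getVert s) ∧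
      G.Adj q (P.getVert (s + 1)) := by
    have h0 : G.dist (b 0) w' ≠ G.dist (b 0) w := fun h => hww' (hPinj _ hw' _ hw h)
    have h1 := hcons w hw w' hw' hqw hqw'
    have h2 := hcons w' hw' w hw hqw' hqw
    have h3 := hPg w hw
    have h4 := hPg w' hw'
    rcases Nat.lt_or_gt_of_ne h0 with h | h
    · have h5 : G.dist (b 0) w' + 1 = G.dist (b 0) w := by omega
      exact ⟨G.dist (b 0) w', by omega, by rwa [h4.2], by rwa [h5, h3.2]⟩
    · have h5 : G.dist (b 0) w + 1 = G.dist (b 0) w' := by omega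
      exact ⟨G.dist (b 0) w, by omega, by rwa [h3.2], by rwa [h5, h4.2]⟩
  have hds := dist_getVert_of_length_eq_dist hP (n := s) (by omega)
  have hds' := dist_getVert_of_length_eq_dist hP hs
  have hqN : ∀ x ∈ P.support, G.Adj q x → x = P.getVert s ∨ x = P.getVert (s + 1) := by
    intro x hx hqx
    have h1 := hcons _ (P.getVert_mem_support s) x hx hqs hqx
    have h2 := hcons x hx _ (P.getVert_mem_support (s + 1)) hqx hqs'
    have h3 := hPg x hx
    have : G.dist (b 0) x = s ∨ G.dist (b 0) x = s + 1 := by omega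
    rcases this with h | h
    · exact Or.inl (by rw [← h, h3.2])
    · exact Or.inr (by rw [← h, h3.2])
  have hT : ∀ x, x ∈ (P.take s).support ↔ x ∈ P.support ∧ G.dist (b 0) x ≤ s := by
    intro x
    constructor
    · intro h
      obtain ⟨n, hn, hn'⟩ := Walk.mem_support_iff_exists_getVert.mp h
      rw [Walk.take_getVert] at hn
      rw [← hn, dist_getVert_of_length_eq_dist hP (by omega)]
      exact ⟨P.getVert_mem_support _, by omega⟩
    · rintro ⟨h, h'⟩
      refine Walk.mem_support_iff_exists_getVert.mpr ⟨G.dist (b 0) x, ?_, ?_⟩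
      · rw [Walk.take_getVert, min_eq_right h', (hPg x h).2]
      · rw [Walk.take_length]
        omega
  have hDr : ∀ x, x ∈ (P.drop (s + 1)).support ↔ x ∈ P.support ∧ s + 1 ≤ G.dist (b 0) x := by
    intro x
    constructor
    · intro h
      obtain ⟨n, hn, hn'⟩ := Walk.mem_support_iff_exists_getVert.mp h
      rw [Walk.drop_getVert] at hn
      rw [Walk.drop_length] at hn'
      rw [← hn, dist_getVert_of_length_eq_dist hP (by omega)]
      exact ⟨P.getVert_mem_support _, by omega⟩
    · rintro ⟨h, h'⟩
      have h1 := hPg x h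
      refine Walk.mem_support_iff_exists_getVert.mpr ⟨G.dist (b 0) x - (s + 1), ?_, ?_⟩
      · rw [Walk.drop_getVert, Nat.add_sub_cancel' h', h1.2]
      · rw [Walk.drop_length]
        omega
  have hTg := length_eq_dist_of_subwalk hP (P.isSubwalk_take s)
  have hDg := length_eq_dist_of_subwalk hP (P.isSubwalk_drop (s + 1))
  obtain ⟨y, hy0, hy1, hy2⟩ : ∃ y : Fin 3 → α, y 0 = P.getVert s ∧ y 1 = P.getVert (s + 1) ∧
      y 2 = q := ⟨![P.getVert s, P.getVert (s + 1), q], rfl, rfl, rfl⟩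
  let R : Fin 3 → Set α := ![{x | x ∈ (P.take s).support}, {x | x ∈ (P.drop (s + 1)).support},
    {x | x ∈ Q.support}]
  have hS : ∀ i, ∃ S : G.Walk (y i) (b i), S.IsPath ∧ (∀ x, x ∈ S.support ↔ x ∈ R i) ∧
      ∀ x ∈ R i, ∀ z ∈ R i, G.Adj x z → s(x, z) ∈ S.edges := by
    intro i
    fin_cases i
    · refine ⟨((P.take s).copy rfl hy0.symm).reverse, ?_, ?_, ?_⟩
      · simpa using Walk.isPath_of_length_eq_dist _ hTg
      · simp [R]
      · intro x hx z hz h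
        simpa using mem_edges_of_length_eq_dist hTg hx hz h
    · refine ⟨(P.drop (s + 1)).copy hy1.symm rfl, ?_, ?_, ?_⟩
      · simpa using Walk.isPath_of_length_eq_dist _ hDg
      · simp [R]
      · intro x hx z hz h
        simpa using mem_edges_of_length_eq_dist hDg hx hz h
    · refine ⟨(Q.copy rfl hy2.symm).reverse, ?_, ?_, ?_⟩
      · simpa using Walk.isPath_of_length_eq_dist _ hQ
      · simp [R]
      · intro x hx z hz h
        simpa using mem_edges_of_length_eq_dist hQ hx hz h
  choose S hSp hSs hSe using hS
  have hss' : G.Adj (P.getVert s) (P.getVert (s + 1)) := P.adj_getVert_succ (by omega)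
  have hadj : ∀ i j, i < j → G.Adj (y i) (y j) := by
    have h01 : G.Adj (y 0) (y 1) := by rwa [hy0, hy1]
    have h02 : G.Adj (y 0) (y 2) := by rw [hy0, hy2]; exact hqs.symm
    have h12 : G.Adj (y 1) (y 2) := by rw [hy1, hy2]; exact hqs'.symm
    intro i j hij
    fin_cases i <;> fin_cases j <;> first | exact h01 | exact h02 | exact h12 | simp at hij
  have hR : ∀ x, ∃ i, x ∈ R i := by
    intro x
    rcases hall x with h | h
    · rcases le_or_gt (G.dist (b 0) x) s with h' | h'
      · exact ⟨0, (hT x).2 ⟨h, h'⟩⟩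
      · exact ⟨1, (hDr x).2 ⟨h, h'⟩⟩
    · exact ⟨2, h⟩
  have hRd : ∀ i j, i < j → ∀ x, x ∈ R i → x ∉ R j := by
    intro i j hij x hi hj
    fin_cases i <;> fin_cases j <;> simp at hij
    · have := ((hT x).1 hi).2
      have := ((hDr x).1 hj).2
      omega
    · exact hPQ x ((hT x).1 hi).1 hj
    · exact hPQ x ((hDr x).1 hi).1 hj
  have hRe : ∀ i j, i < j → ∀ x ∈ R i, ∀ z ∈ R j, G.Adj x z → x = y i ∧ z = y j := by
    intro i j hij x hi z hj hxz
    fin_cases i <;> fin_cases j <;> simp at hij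
    · obtain ⟨h1, h2⟩ := (hT x).1 hi
      obtain ⟨h3, h4⟩ := (hDr z).1 hj
      have h5 := hxz.diff_dist_adj (u := b 0)
      constructor
      · exact (hPinj x h1 _ (P.getVert_mem_support s) (by omega)).trans hy0.symm
      · exact (hPinj z h3 _ (P.getVert_mem_support _) (by omega)).trans hy1.symm
    · obtain ⟨h1, h2⟩ := (hT x).1 hi
      obtain rfl := hcross z hj x h1 hxz.symm
      refine ⟨?_, hy2.symm⟩
      rcases hqN x h1 hxz.symm with rfl | rfl
      · exact hy0.symm
      · omega
    · obtain ⟨h1, h2⟩ := (hDr x).1 hi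
      obtain rfl := hcross z hj x h1 hxz.symm
      refine ⟨?_, hy2.symm⟩
      rcases hqN x h1 hxz.symm with rfl | rfl
      · omega
      · exact hy1.symm
  refine ⟨y, S, fun i j hij => ?_, hSp, fun i j z hi hj => ?_, fun z => ?_, ?_⟩
  · rcases lt_or_gt_of_ne hij with h | h
    · exact hadj i j h
    · exact (hadj j i h).symm
  · rw [hSs] at hi hj
    by_contra hij
    rcases lt_or_gt_of_ne hij with h | h
    · exact hRd i j h z hi hj
    · exact hRd j i h z hj hi
  · simpa [hSs] using hR z
  · intro z _ w _ hzw
    obtain ⟨i, hi⟩ := hR z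
    obtain ⟨j, hj⟩ := hR w
    rcases lt_trichotomy i j with h | rfl | h
    · exact Or.inl ⟨i, j, h.ne, hRe i j h z hi w hj hzw⟩
    · exact Or.inr ⟨i, hSe i z hi w hj hzw⟩
    · exact Or.inl ⟨i, j, h.ne', (hRe j i h w hj z hi hzw.symm).symm⟩

/-- The restriction of a set inducing minimum degree two to an induced subgraph. -/
lemma minDegree_two_preimage_val {G : SimpleGraph α} {D Z : Set α} (hZD : Z ⊆ D)
    (hZ : Z.Finite) (hne : Z.Nonempty)
    (hdeg : ∀ x ∈ Z, ∃ y ∈ Z, ∃ z ∈ Z, y ≠ z ∧ G.Adj x y ∧ G.Adj x z) :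
    (Subtype.val ⁻¹' Z : Set D).Finite ∧ (Subtype.val ⁻¹' Z : Set D).Nonempty ∧
      ∀ x ∈ (Subtype.val ⁻¹' Z : Set D), ∃ y ∈ (Subtype.val ⁻¹' Z : Set D),
        ∃ z ∈ (Subtype.val ⁻¹' Z : Set D), y ≠ z ∧
          (G.induce D).Adj x y ∧ (G.induce D).Adj x z := by
  refine ⟨hZ.preimage Subtype.val_injective.injOn, ?_, ?_⟩
  · obtain ⟨x, hx⟩ := hne
    exact ⟨⟨x, hZD hx⟩, hx⟩
  · rintro ⟨x, hxD⟩ hx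
    obtain ⟨y, hy, z, hz, hyz, hxy, hxz⟩ := hdeg x hx
    exact ⟨⟨y, hZD hy⟩, hy, ⟨z, hZD hz⟩, hz, fun h => hyz (congrArg Subtype.val h), hxy, hxz⟩

lemma exists_isNet {G : SimpleGraph α} {D : Set α} (hD : (G.induce D).Connected) (b : Fin 3 → α)
    (hb : ∀ i, b i ∈ D)
    (hmin : ∀ D' ⊆ D, (G.induce D').Connected → (∀ i, b i ∈ D') → D ⊆ D')
    {Z : Set α} (hZD : Z ⊆ D) (hZ : Z.Finite) (hne : Z.Nonempty)
    (hdeg : ∀ x ∈ Z, ∃ y ∈ Z, ∃ z ∈ Z, y ≠ z ∧ G.Adj x y ∧ G.Adj x z) :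
    ∃ y S, IsNet G D b y S := by
  obtain ⟨hZ', hne', hdeg'⟩ := minDegree_two_preimage_val hZD hZ hne hdeg
  obtain ⟨y, S, hS⟩ := exists_isNet_univ hD (fun i => ⟨b i, hb i⟩) (fun D' hD' hbD' x => by
    have := hmin (Subtype.val '' D') (by simp) (induce_connected_image_val.mp hD')
      (fun i => ⟨_, hbD' i, rfl⟩) x.2
    obtain ⟨x', hx', h⟩ := this
    rwa [← Subtype.ext h]) hZ' hne' hdeg'
  let f : G.induce D →g G := (Embedding.induce D).toHom
  let S' : ∀ i, G.Walk (y i).1 (b i) := fun i => (S i).map f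
  have hsupp : ∀ i z, z ∈ (S' i).support ↔ ∃ w ∈ (S i).support, w.1 = z := fun i z => by
    change z ∈ ((S i).map f).support ↔ _
    rw [Walk.support_map, List.mem_map]
    rfl
  refine ⟨fun i => (y i).1, S', fun i j hij => hS.adj i j hij, fun i => ?_, fun i j z hi hj => ?_,
    fun z => ?_, fun z hz w hw hzw => ?_⟩
  · exact (Walk.isPath_map_iff_of_injective Subtype.val_injective).mpr (hS.isPath i)
  · obtain ⟨w, hw, rfl⟩ := (hsupp i z).mp hi
    obtain ⟨w', hw', h⟩ := (hsupp j _).mp hj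
    obtain rfl := Subtype.ext h
    exact hS.disjoint i j _ hw hw'
  · constructor
    · intro hz
      obtain ⟨i, hi⟩ := (hS.mem_iff ⟨z, hz⟩).mp trivial
      exact ⟨i, (hsupp i z).mpr ⟨_, hi, rfl⟩⟩
    · rintro ⟨i, hi⟩
      obtain ⟨w, -, rfl⟩ := (hsupp i z).mp hi
      exact w.2
  · rcases hS.edge ⟨z, hz⟩ trivial ⟨w, hw⟩ trivial hzw with ⟨i, j, hij, h1, h2⟩ | ⟨i, hi⟩
    · exact Or.inl ⟨i, j, hij, congrArg Subtype.val h1, congrArg Subtype.val h2⟩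
    · refine Or.inr ⟨i, ?_⟩
      change _ ∈ ((S i).map f).edges
      rw [Walk.edges_map, List.mem_map]
      exact ⟨_, hi, rfl⟩

lemma induce_connected_getVert_image {G : SimpleGraph α} {u v : α} (p : G.Walk u v) {i j : ℕ}
    (hij : i ≤ j) (hj : j ≤ p.length) : (G.induce (p.getVert '' Set.Icc i j)).Connected := by
  refine induce_connected_of_reachIn ⟨i, ⟨le_rfl, hij⟩, rfl⟩ ?_
  rintro _ ⟨m, ⟨him, hmj⟩, rfl⟩
  induction m, him using Nat.le_induction with
  | base => exact ReachIn.refl ⟨i, ⟨le_rfl, hij⟩, rfl⟩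
  | succ m him ih =>
    exact (ih (by omega)).trans (ReachIn.of_adj ⟨m, ⟨him, by omega⟩, rfl⟩
      ⟨m + 1, ⟨by omega, hmj⟩, rfl⟩ (p.adj_getVert_succ (by omega)))

/-- A cycle splits into three connected arcs containing three prescribed vertices. -/
lemma SimpleGraph.Walk.IsCycle.exists_arcs {G : SimpleGraph α} {x : α} {c : G.Walk x x}
    (hc : c.IsCycle) {a : Fin 3 → α} (ha : Function.Injective a) (hac : ∀ i, a i ∈ c.support) :
    ∃ A : Fin 3 → Set α, (∀ i, a i ∈ A i) ∧ (∀ i, ∀ z ∈ A i, z ∈ c.support) ∧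
      (∀ i, (G.induce (A i)).Connected) ∧ (∀ i j, i ≠ j → Disjoint (A i) (A j)) ∧
      ∀ i j, i ≠ j → ∃ x ∈ A i, ∃ y ∈ A j, G.Adj x y := by
  classical
  have key : ∀ (u : α) (c : G.Walk u u), c.IsCycle → ∀ i j, 0 < i → i < j → j < c.length →
      ∃ A B C : Set α, (u ∈ A ∧ c.getVert i ∈ B ∧ c.getVert j ∈ C) ∧
        ((∀ z ∈ A, z ∈ c.support) ∧ (∀ z ∈ B, z ∈ c.support) ∧ (∀ z ∈ C, z ∈ c.support)) ∧
        ((G.induce A).Connected ∧ (G.induce B).Connected ∧ (G.induce C).Connected) ∧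
        (Disjoint A B ∧ Disjoint A C ∧ Disjoint B C) ∧
        (∃ x ∈ A, ∃ y ∈ B, G.Adj x y) ∧ (∃ x ∈ A, ∃ y ∈ C, G.Adj x y) ∧
        ∃ x ∈ B, ∃ y ∈ C, G.Adj x y := by
    intro u c hc i j hi hij hj
    have hdis : ∀ k l m n, l < m → n < c.length →
        Disjoint (c.getVert '' Set.Icc k l) (c.getVert '' Set.Icc m n) := by
      intro k l m n hlm hn
      rw [Set.disjoint_left]
      rintro _ ⟨p, ⟨hp1, hp2⟩, rfl⟩ ⟨q, ⟨hq1, hq2⟩, hpq⟩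
      have := hc.getVert_injOn' (show q ≤ _ by omega) (show p ≤ _ by omega) hpq
      omega
    have hsub : ∀ k l, ∀ z ∈ c.getVert '' Set.Icc k l, z ∈ c.support := by
      rintro k l _ ⟨m, -, rfl⟩
      exact c.getVert_mem_support m
    refine ⟨c.getVert '' Set.Icc 0 (i - 1), c.getVert '' Set.Icc i (j - 1),
      c.getVert '' Set.Icc j (c.length - 1), ⟨⟨0, by simp, by simp⟩, ⟨i, ⟨by omega, by omega⟩, rfl⟩,
      ⟨j, ⟨by omega, by omega⟩, rfl⟩⟩, ⟨hsub _ _, hsub _ _, hsub _ _⟩,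
      ⟨induce_connected_getVert_image c (by omega) (by omega),
        induce_connected_getVert_image c (by omega) (by omega),
        induce_connected_getVert_image c (by omega) (by omega)⟩,
      ⟨hdis _ _ _ _ (by omega) (by omega), hdis _ _ _ _ (by omega) (by omega),
        hdis _ _ _ _ (by omega) (by omega)⟩, ?_, ?_, ?_⟩
    · refine ⟨_, ⟨i - 1, ⟨by omega, by omega⟩, rfl⟩, _, ⟨i, ⟨by omega, by omega⟩, rfl⟩, ?_⟩
      have := c.adj_getVert_succ (i := i - 1) (by omega)
      rwa [Nat.sub_add_cancel (by omega)] at this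
    · refine ⟨_, ⟨0, ⟨by omega, by omega⟩, rfl⟩, _,
        ⟨c.length - 1, ⟨by omega, by omega⟩, rfl⟩, ?_⟩
      have := c.adj_getVert_succ (i := c.length - 1) (by omega)
      rw [Nat.sub_add_cancel (by omega), Walk.getVert_length] at this
      rw [Walk.getVert_zero]
      exact this.symm
    · refine ⟨_, ⟨j - 1, ⟨by omega, by omega⟩, rfl⟩, _, ⟨j, ⟨by omega, by omega⟩, rfl⟩, ?_⟩
      have := c.adj_getVert_succ (i := j - 1) (by omega)
      rwa [Nat.sub_add_cancel (by omega)] at this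
  have key' : ∃ A B C : Set α, (a 0 ∈ A ∧ a 1 ∈ B ∧ a 2 ∈ C) ∧
        ((∀ z ∈ A, z ∈ c.support) ∧ (∀ z ∈ B, z ∈ c.support) ∧ (∀ z ∈ C, z ∈ c.support)) ∧
        ((G.induce A).Connected ∧ (G.induce B).Connected ∧ (G.induce C).Connected) ∧
        (Disjoint A B ∧ Disjoint A C ∧ Disjoint B C) ∧
        (∃ x ∈ A, ∃ y ∈ B, G.Adj x y) ∧ (∃ x ∈ A, ∃ y ∈ C, G.Adj x y) ∧
        ∃ x ∈ B, ∃ y ∈ C, G.Adj x y := by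
    have hc' := hc.rotate (hac 0)
    have hmem : ∀ z, z ∈ (c.rotate (a 0) (hac 0)).support ↔ z ∈ c.support := fun z =>
      c.mem_support_rotate_iff (a 0) (hac 0)
    obtain ⟨i, hi, hi'⟩ := Walk.mem_support_iff_exists_getVert.mp ((hmem _).mpr (hac 1))
    obtain ⟨j, hj, hj'⟩ := Walk.mem_support_iff_exists_getVert.mp ((hmem _).mpr (hac 2))
    have h01 : a 0 ≠ a 1 := ha.ne (by decide)
    have h02 : a 0 ≠ a 2 := ha.ne (by decide)
    have h12 : a 1 ≠ a 2 := ha.ne (by decide)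
    have hi0 : i ≠ 0 := by rintro rfl; simp at hi; exact h01 hi
    have hj0 : j ≠ 0 := by rintro rfl; simp at hj; exact h02 hj
    have hil : i ≠ (c.rotate (a 0) (hac 0)).length := by
      rintro rfl; rw [Walk.getVert_length] at hi; exact h01 hi
    have hjl : j ≠ (c.rotate (a 0) (hac 0)).length := by
      rintro rfl; rw [Walk.getVert_length] at hj; exact h02 hj
    have hij : i ≠ j := by rintro rfl; exact h12 (hi.symm.trans hj)
    simp only [← hmem]
    rcases lt_or_gt_of_ne hij with h | h
    · have := key _ _ hc' i j (by omega) h (by omega)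
      rwa [hi, hj] at this
    · obtain ⟨A, B, C, ⟨h1, h2, h3⟩, ⟨h4, h5, h6⟩, ⟨h7, h8, h9⟩, ⟨h10, h11, h12⟩, h13, h14,
        x, hx, y, hy, hxy⟩ := key _ _ hc' j i (by omega) h (by omega)
      rw [hj] at h2
      rw [hi] at h3
      exact ⟨A, C, B, ⟨h1, h3, h2⟩, ⟨h4, h6, h5⟩, ⟨h7, h9, h8⟩, ⟨h11, h10, h12.symm⟩, h14, h13,
        y, hy, x, hx, hxy.symm⟩
  obtain ⟨A, B, C, ⟨h1, h2, h3⟩, ⟨h4, h5, h6⟩, ⟨h7, h8, h9⟩, ⟨h10, h11, h12⟩,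
    ⟨x₁, hx₁, y₁, hy₁, hxy₁⟩, ⟨x₂, hx₂, y₂, hy₂, hxy₂⟩, x₃, hx₃, y₃, hy₃, hxy₃⟩ := key'
  refine ⟨![A, B, C], ?_, ?_, ?_, ?_, ?_⟩
  · intro i; fin_cases i <;> assumption
  · intro i; fin_cases i <;> assumption
  · intro i; fin_cases i <;> assumption
  · intro i j hij
    fin_cases i <;> fin_cases j <;>
      first | exact absurd rfl hij | assumption | (apply Disjoint.symm; assumption)
  · intro i j hij
    fin_cases i <;> fin_cases j
    · exact absurd rfl hij
    · exact ⟨x₁, hx₁, y₁, hy₁, hxy₁⟩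
    · exact ⟨x₂, hx₂, y₂, hy₂, hxy₂⟩
    · exact ⟨y₁, hy₁, x₁, hx₁, hxy₁.symm⟩
    · exact absurd rfl hij
    · exact ⟨x₃, hx₃, y₃, hy₃, hxy₃⟩
    · exact ⟨y₂, hy₂, x₂, hx₂, hxy₂.symm⟩
    · exact ⟨y₃, hy₃, x₃, hx₃, hxy₃.symm⟩
    · exact absurd rfl hij

/-- Two vertices of a cycle are joined by an arc missing some further vertex. -/
lemma SimpleGraph.Walk.IsCycle.exists_short_arc {G : SimpleGraph α} {x u v : α} {c : G.Walk x x}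
    (hc : c.IsCycle) (hu : u ∈ c.support) (hv : v ∈ c.support) :
    ∃ Q : Set α, (G.induce Q).Connected ∧ u ∈ Q ∧ (v = u ∨ ∃ q ∈ Q, G.Adj q v) ∧
      (∀ q ∈ Q, q ∈ c.support) ∧ (∀ q ∈ Q, q = u ∨ q ≠ v) ∧
      ∃ w ∈ c.support, w ∉ Q ∧ w ≠ u ∧ w ≠ v := by
  classical
  have hc' := hc.rotate hu
  have hmem : ∀ z, z ∈ (c.rotate u hu).support ↔ z ∈ c.support := fun z =>
    c.mem_support_rotate_iff u hu
  simp only [← hmem] at hv ⊢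
  generalize c.rotate u hu = c at hc' hv
  have h3 := hc'.three_le_length
  have hinj := hc'.getVert_injOn'
  have hne : ∀ i j, i < c.length → j < c.length → i ≠ j → c.getVert i ≠ c.getVert j :=
    fun i j hi hj hij h => hij (hinj (show i ≤ _ by omega) (show j ≤ _ by omega) h)
  obtain ⟨i, rfl, hi⟩ := Walk.mem_support_iff_exists_getVert.mp hv
  have h0 : ∀ j, 0 < j → j < c.length → c.getVert j ≠ u := fun j hj hj' h =>
    hne j 0 hj' (by omega) (by omega) (by simpa using h)
  by_cases hiu : c.getVert i = u
  · refine ⟨{u}, induce_connected_singleton G u, rfl, Or.inl hiu, ?_, fun q hq => Or.inl hq,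
      c.getVert 1, c.getVert_mem_support _, h0 1 (by omega) (by omega), h0 1 (by omega) (by omega),
      ?_⟩
    · rintro q rfl
      exact c.start_mem_support
    · rw [hiu]
      exact h0 1 (by omega) (by omega)
  have hi0 : i ≠ 0 := by rintro rfl; simp at hiu
  have hil : i ≠ c.length := by rintro rfl; simp at hiu
  by_cases hi1 : i = 1
  · subst hi1
    refine ⟨{u}, induce_connected_singleton G u, rfl, Or.inr ⟨u, rfl, ?_⟩, ?_,
      fun q hq => Or.inl hq, c.getVert 2, c.getVert_mem_support _, h0 2 (by omega) (by omega),
      h0 2 (by omega) (by omega), hne 2 1 (by omega) (by omega) (by omega)⟩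
    · simpa using c.adj_getVert_succ (i := 0) (by omega)
    · rintro q rfl
      exact c.start_mem_support
  · refine ⟨c.getVert '' Set.Icc (i + 1) c.length,
      induce_connected_getVert_image c (by omega) le_rfl,
      ⟨c.length, ⟨by omega, le_rfl⟩, by simp⟩, Or.inr ⟨_, ⟨i + 1, ⟨le_rfl, by omega⟩, rfl⟩,
      (c.adj_getVert_succ (by omega)).symm⟩, ?_, ?_, c.getVert 1, c.getVert_mem_support _, ?_,
      h0 1 (by omega) (by omega), hne 1 i (by omega) (by omega) (by omega)⟩
    · rintro _ ⟨m, -, rfl⟩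
      exact c.getVert_mem_support m
    · rintro _ ⟨m, ⟨hm, hm'⟩, rfl⟩
      rcases hm'.eq_or_lt with rfl | h
      · exact Or.inl c.getVert_length
      · exact Or.inr (hne m i h (by omega) (by omega))
    · rintro ⟨m, ⟨hm, hm'⟩, h⟩
      rcases hm'.eq_or_lt with rfl | h'
      · rw [c.getVert_length] at h
        exact h0 1 (by omega) (by omega) h.symm
      · exact hne m 1 h' (by omega) (by omega) h

lemma SimpleGraph.Walk.IsCycle.exists_two_adj {G : SimpleGraph α} {u x : α} {c : G.Walk u u}
    (hc : c.IsCycle) (hx : x ∈ c.support) :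
    ∃ y ∈ c.support, ∃ z ∈ c.support, y ≠ z ∧ G.Adj x y ∧ G.Adj x z := by
  obtain ⟨y, z, hyz, h⟩ := Set.ncard_eq_two.mp (hc.ncard_neighborSet_toSubgraph_eq_two hx)
  have hy : c.toSubgraph.Adj x y := by
    change y ∈ c.toSubgraph.neighborSet x
    simp [h]
  have hz : c.toSubgraph.Adj x z := by
    change z ∈ c.toSubgraph.neighborSet x
    simp [h]
  exact ⟨y, (c.mem_verts_toSubgraph).mp hy.snd_mem, z, (c.mem_verts_toSubgraph).mp hz.snd_mem, hyz,
    hy.adj_sub, hz.adj_sub⟩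

/-- A component of the complement of a cycle in a `K₄`-minimal graph which contains a cycle
has three distinct attachments. -/
lemma exists_three_attachments {G : SimpleGraph α} (hconn : G.Connected) {H : SimpleGraph β}
    (hH : ∀ i j, i ≠ j → H.Adj i j) (hmin : MinorMinimal G H)
    {x : α} {c : G.Walk x x} (hc : c.IsCycle) {D : Set α} (hD : (G.induce D).Connected)
    (hDc : ∀ z ∈ D, z ∉ c.support) (hcl : ∀ z ∈ D, ∀ w ∉ D, G.Adj z w → w ∈ c.support)
    {Z : Set α} (hZD : Z ⊆ D) (hZ : Z.Finite) (hne : Z.Nonempty)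
    (hdeg : ∀ x ∈ Z, ∃ y ∈ Z, ∃ z ∈ Z, y ≠ z ∧ G.Adj x y ∧ G.Adj x z) :
    ∃ t : Fin 3 → α, Function.Injective t ∧ (∀ i, t i ∈ c.support) ∧
      ∀ i, ∃ d ∈ D, G.Adj (t i) d := by
  by_contra hno
  obtain ⟨z₀, hz₀⟩ := hne
  obtain ⟨u, huD, huN⟩ : ∃ u, u ∉ D ∧ ∃ d ∈ D, G.Adj u d := by
    obtain ⟨p⟩ := hconn.preconnected z₀ x
    obtain ⟨d, -, hd1, hd2⟩ := p.exists_boundary_dart D (hZD hz₀)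
      fun h => hDc x h c.start_mem_support
    exact ⟨d.snd, hd2, d.fst, hd1, d.adj.symm⟩
  obtain ⟨v, hvD, hvN, hsep⟩ : ∃ v, v ∉ D ∧ (∃ d ∈ D, G.Adj v d) ∧
      ∀ x ∈ D, ∀ y ∉ D, G.Adj x y → y = u ∨ y = v := by
    by_cases hone : ∀ x ∈ D, ∀ y ∉ D, G.Adj x y → y = u
    · exact ⟨u, huD, huN, fun x hx y hy h => Or.inl (hone x hx y hy h)⟩
    · push Not at hone
      obtain ⟨d, hd, v, hv, hdv, hvu⟩ := hone
      refine ⟨v, hv, ⟨d, hd, hdv.symm⟩, fun e he w hw hew => ?_⟩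
      by_contra! hwuv
      refine hno ⟨![u, v, w], ?_, ?_, ?_⟩
      · intro i j hij
        fin_cases i <;> fin_cases j <;> simp_all [eq_comm]
      · obtain ⟨d', hd', hud'⟩ := huN
        intro i
        fin_cases i
        · exact hcl d' hd' u huD hud'.symm
        · exact hcl d hd v hv hdv
        · exact hcl e he w hw hew
      · intro i
        fin_cases i
        · exact huN
        · exact ⟨d, hd, hdv.symm⟩
        · exact ⟨e, he, hew.symm⟩
  obtain ⟨d, hd, hud⟩ := huN
  obtain ⟨e, he, hve⟩ := hvN
  have huc := hcl d hd u huD hud.symm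
  have hvc := hcl e he v hvD hve.symm
  obtain ⟨V, hV⟩ := hmin.1
  by_cases hVD : ∀ i, ¬ V i ⊆ D
  · by_cases huv : v = u
    · exact false_of_two_separation hmin hV huD hvD hsep hVD (induce_connected_singleton G u) rfl
        (Or.inl huv) (fun q hq => Or.inl hq) hd (fun h => huD (h ▸ hd))
    · obtain ⟨p, hp⟩ := hD.exists_walk_length_eq_dist ⟨d, hd⟩ ⟨e, he⟩
      have hpc : (G.induce (Subtype.val '' {z | z ∈ p.support})).Connected :=
        induce_connected_image_val.mp p.connected_induce_support
      obtain ⟨w, hw⟩ : ∃ w, w ∉ p.support := by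
        by_contra! hall
        obtain ⟨h1, h2, h3⟩ := minDegree_two_preimage_val hZD hZ ⟨z₀, hz₀⟩ hdeg
        exact false_of_forall_mem_geodesic h1 h2 h3 hp hall
      refine false_of_two_separation hmin hV huD hvD hsep hVD
        (induce_connected_insert hpc ⟨_, p.start_mem_support, rfl⟩ hud) (Set.mem_insert _ _)
        (Or.inr ⟨e, Or.inr ⟨_, p.end_mem_support, rfl⟩, hve.symm⟩) ?_ w.2 ?_
      · rintro q (rfl | ⟨q, -, rfl⟩)
        · exact Or.inl rfl
        · exact Or.inr q.2
      · rintro (h | ⟨q, hq, h⟩)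
        · exact huD (h ▸ w.2)
        · exact hw (Subtype.ext h ▸ hq)
  · push Not at hVD
    obtain ⟨i, hi⟩ := hVD
    obtain ⟨Q, hQ, huQ, hQv, hQc, hQuv, w, hwc, hwQ, hwu, hwv⟩ := hc.exists_short_arc huc hvc
    refine false_of_two_separation hmin hV (D := {z | z ∉ D ∧ z ≠ u ∧ z ≠ v}) (u := u) (v := v)
      (by simp) (by simp) ?_ ?_ hQ huQ hQv ?_ (w := w) ⟨fun h => hDc w h hwc, hwu, hwv⟩ hwQ
    · rintro x ⟨hxD, hxu, hxv⟩ y hy hxy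
      by_contra! hyuv
      by_cases hyD : y ∈ D
      · have := hsep y hyD x hxD hxy.symm
        tauto
      · exact hy ⟨hyD, hyuv⟩
    · intro j hj
      by_cases hij : i = j
      · subst hij
        obtain ⟨z, hz⟩ := hV.1 i
        exact (hj hz).1 (hi hz)
      · obtain ⟨y, hy, z, hz, hyz⟩ := hV.2.2.2 i j (hH i j hij)
        obtain ⟨h1, h2, h3⟩ := hj hz
        exact (hsep y (hi hy) z h1 hyz).elim h2 h3
    · intro q hq
      by_cases hqu : q = u
      · exact Or.inl hqu
      · exact Or.inr ⟨fun h => hDc q h (hQc q hq), hqu, (hQuv q hq).resolve_left hqu⟩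

lemma SimpleGraph.Walk.IsPath.reachIn_of_ne_end {G : SimpleGraph α} {u v z : α} {p : G.Walk u v}
    (hp : p.IsPath) (hz : z ∈ p.support) (hzv : z ≠ v) :
    ReachIn G {w | w ∈ p.support ∧ w ≠ v} u z := by
  obtain ⟨n, rfl, hn⟩ := Walk.mem_support_iff_exists_getVert.mp hz
  refine reachIn_of_connected (induce_connected_getVert_image p n.zero_le hn) ?_
    ⟨0, ⟨le_rfl, n.zero_le⟩, p.getVert_zero⟩ ⟨n, ⟨n.zero_le, le_rfl⟩, rfl⟩
  rintro _ ⟨m, ⟨-, hm⟩, rfl⟩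
  refine ⟨p.getVert_mem_support m, fun h => ?_⟩
  have : m = p.length := hp.getVert_injOn (show m ≤ _ by omega) (show p.length ≤ _ from le_rfl)
    (h.trans p.getVert_length.symm)
  obtain rfl : n = p.length := by omega
  exact hzv p.getVert_length

lemma SimpleGraph.Walk.IsPath.reachIn_of_ne_start {G : SimpleGraph α} {u v z : α} {p : G.Walk u v}
    (hp : p.IsPath) (hz : z ∈ p.support) (hzu : z ≠ u) :
    ReachIn G {w | w ∈ p.support ∧ w ≠ u} z v := by
  have := (hp.reverse.reachIn_of_ne_end (by simpa using hz) hzu).symm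
  exact this.mono fun w hw => ⟨by simpa using hw.1, hw.2⟩

/-- The complement of a cycle `c` in a connected `K₄`-minimal graph is a net, provided that it
contains a cycle and that three disjoint edges leave `c`. -/
lemma exists_isNet_compl_cycle {G : SimpleGraph α} (hconn : G.Connected)
    (hmin : MinorMinimal G (⊤ : SimpleGraph (Fin 4)))
    {x₁ x₂ : α} {c₁ : G.Walk x₁ x₁} {c₂ : G.Walk x₂ x₂}
    (hc₁ : c₁.IsCycle) (hc₂ : c₂.IsCycle) (hdisj : ∀ z, z ∈ c₁.support → z ∉ c₂.support)
    {a b : Fin 3 → α} (ha : Function.Injective a) (hab : ∀ i, G.Adj (a i) (b i))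
    (haC : ∀ i, a i ∈ c₁.support) (hbC : ∀ i, b i ∉ c₁.support) :
    ∃ y S, IsNet G {z | z ∉ c₁.support} b y S := by
  have hwheel : ∀ t : Fin 3 → α, Function.Injective t → (∀ i, t i ∈ c₁.support) →
      ∀ D : Set α, (G.induce D).Connected → (∀ z ∈ D, z ∉ c₁.support) →
      (∀ i, ∃ d ∈ D, G.Adj (t i) d) → ∀ z, z ∉ c₁.support → z ∈ D := by
    intro t ht htc D hD hDc htD z hz
    obtain ⟨A, htA, hAc, hA, hAA, hadj⟩ := hc₁.exists_arcs ht htc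
    exact mem_of_wheel_of_minorMinimal hmin hA hAA hadj hD
      (fun i => Set.disjoint_left.mpr fun w hw hwD => hDc w hwD (hAc i w hw))
      (fun i => ⟨t i, htA i, htD i⟩) z fun i hzi => hz (hAc i z hzi)
  have hZ : ({z | z ∈ c₂.support} : Set α).Finite := c₂.support.finite_toSet
  have hne : ({z | z ∈ c₂.support} : Set α).Nonempty := ⟨x₂, c₂.start_mem_support⟩
  have hdeg : ∀ x ∈ {z | z ∈ c₂.support}, ∃ y ∈ {z | z ∈ c₂.support}, ∃ z ∈ {z | z ∈ c₂.support},
      y ≠ z ∧ G.Adj x y ∧ G.Adj x z := fun x hx => hc₂.exists_two_adj hx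
  have hZc : {z | z ∈ c₂.support} ⊆ {z | z ∉ c₁.support} := fun z hz h => hdisj z h hz
  have hD : (G.induce {z | z ∉ c₁.support}).Connected := by
    let D : Set α := {z | ReachIn G {z | z ∉ c₁.support} x₂ z}
    have hDc : ∀ z ∈ D, z ∉ c₁.support := fun z ⟨p, hp⟩ => hp z p.end_mem_support
    have hDconn : (G.induce D).Connected := by
      refine induce_connected_of_reachIn (u := x₂)
        (ReachIn.refl (hZc c₂.start_mem_support)) ?_
      rintro z ⟨p, hp⟩
      classical
      exact ⟨p, fun w hw => ⟨p.takeUntil w hw, fun v hv =>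
        hp v (p.support_takeUntil_subset_support hw hv)⟩⟩
    have hcl : ∀ z ∈ D, ∀ w ∉ D, G.Adj z w → w ∈ c₁.support := fun z hz w hw hzw => by
      by_contra hwc
      exact hw (ReachIn.trans hz (ReachIn.of_adj (hDc z hz) hwc hzw))
    have hZD : {z | z ∈ c₂.support} ⊆ D := fun z hz =>
      reachIn_of_connected (s := {z | z ∈ c₂.support}) c₂.connected_induce_support hZc
        c₂.start_mem_support hz
    obtain ⟨t, ht, htc, htD⟩ := exists_three_attachments hconn (by simp) hmin hc₁ hDconn hDc hcl
      hZD hZ hne hdeg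
    have hDeq : D = {z | z ∉ c₁.support} :=
      Set.Subset.antisymm hDc fun z hz => hwheel t ht htc D hDconn hDc htD z hz
    rwa [hDeq] at hDconn
  exact exists_isNet hD b hbC (fun D' hD' hconn' hbD' z hz =>
    hwheel a ha haC D' hconn' (fun w hw => hD' hw) (fun i => ⟨b i, hbD' i, hab i⟩) z hz)
    hZc hZ hne hdeg

/-- A `K₄`-minimal graph in which the complement of a connected subgraph of minimum degree two
is a net, with terminals adjacent to that subgraph, consists of two triangles and three paths. -/
lemma IsNet.twoTrianglesThreePaths {G : SimpleGraph α}
    (hmin : MinorMinimal G (⊤ : SimpleGraph (Fin 4))) {C : Set α} (hC : (G.induce C).Connected)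
    (hCfin : C.Finite) (hdeg : ∀ x ∈ C, ∃ y ∈ C, ∃ z ∈ C, y ≠ z ∧ G.Adj x y ∧ G.Adj x z)
    {a b y : Fin 3 → α} (haC : ∀ i, a i ∈ C) (hab : ∀ i, G.Adj (a i) (b i))
    {S : ∀ i, G.Walk (y i) (b i)} (hS : IsNet G {z | z ∉ C} b y S) :
    TwoTrianglesThreePaths G := by
  let D : Set α := {z | ∀ i, z ≠ y i}
  have hyC : ∀ i, y i ∉ C := fun i => (hS.mem_iff _).mpr ⟨i, (S i).start_mem_support⟩
  have hy : ∀ i j, y i = y j → i = j := fun i j h =>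
    hS.disjoint i j (y i) (S i).start_mem_support (by rw [h]; exact (S j).start_mem_support)
  have hCD : C ⊆ D := fun z hz i h => hyC i (h ▸ hz)
  have hDy : ∀ z, z ∉ D → ∃ i, z = y i := fun z hz => by
    by_contra! h
    exact hz h
  have hwheel : ∀ D' ⊆ D, (G.induce D').Connected → (∀ i, ∃ d ∈ D', G.Adj (y i) d) → D ⊆ D' :=
    fun D' hD' hconn hatt z hz => mem_of_wheel_of_minorMinimal hmin (A := fun i => {y i})
      (fun i => induce_connected_singleton G (y i))
      (fun i j hij => Set.disjoint_singleton.mpr fun h => hij (hy i j h))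
      (fun i j hij => ⟨y i, rfl, y j, rfl, hS.adj i j hij⟩) hconn
      (fun i => Set.disjoint_singleton_left.mpr fun h => hD' h i rfl)
      (fun i => ⟨y i, rfl, hatt i⟩) z hz
  obtain ⟨b', hb'⟩ : ∃ b' : Fin 3 → α, ∀ i, b' i ∈ D ∧ G.Adj (y i) (b' i) := by
    refine ⟨fun i => ((S i).concat (hab i).symm).getVert 1, fun i => ?_⟩
    have hadj : G.Adj (y i) (((S i).concat (hab i).symm).getVert 1) := by
      simpa using ((S i).concat (hab i).symm).adj_getVert_succ (i := 0)
        (by rw [Walk.length_concat]; omega)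
    refine ⟨fun j h => ?_, hadj⟩
    have hmem := ((S i).concat (hab i).symm).getVert_mem_support 1
    rw [Walk.support_concat, List.mem_append, List.mem_singleton] at hmem
    dsimp only at h
    rw [h] at hmem hadj
    rcases hmem with hmem | hmem
    · rw [hS.disjoint i j _ hmem (S j).start_mem_support] at hadj
      exact hadj.ne rfl
    · exact hyC j (hmem ▸ haC i)
  have hD : (G.induce D).Connected := by
    refine induce_connected_of_reachIn (hCD (haC 0)) fun z hz => ?_
    by_cases hzC : z ∈ C
    · exact reachIn_of_connected hC hCD (haC 0) hzC
    · obtain ⟨i, hi⟩ := (hS.mem_iff z).mp hzC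
      have hr : ReachIn G D z (b i) := ((hS.isPath i).reachIn_of_ne_start hi (hz i)).mono
        fun w hw j h => hw.2 (by
          rw [h, hS.disjoint i j w hw.1 (h ▸ (S j).start_mem_support)])
      obtain ⟨p, hp⟩ := hr
      exact ((reachIn_of_connected hC hCD (haC 0) (haC i)).trans (ReachIn.of_adj (hCD (haC i))
        (hp _ p.end_mem_support) (hab i))).trans (ReachIn.symm ⟨p, hp⟩)
  obtain ⟨x, T, hT⟩ := exists_isNet hD b' (fun i => (hb' i).1)
    (fun D' hD' hconn hbD' => hwheel D' hD' hconn fun i => ⟨b' i, hbD' i, (hb' i).2⟩)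
    hCD hCfin ⟨a 0, haC 0⟩ hdeg
  have hTD : ∀ i z, z ∈ (T i).support → z ∈ D := fun i z hz => (hT.mem_iff z).mpr ⟨i, hz⟩
  have hedge : ∀ i, ∀ w ∈ D, G.Adj (y i) w → w = b' i := by
    intro i w hw hyw
    by_contra hwb
    have hne : ∀ k, k ≠ i → ∀ z ∈ (T k).support, z ≠ b' i := fun k hk z hz h =>
      hk (hT.disjoint k i z hz (h ▸ (T i).end_mem_support))
    have hconn : (G.induce {z | z ∈ D ∧ z ≠ b' i}).Connected := by
      obtain ⟨j, hj⟩ := exists_ne i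
      have hxj : x j ∈ {z | z ∈ D ∧ z ≠ b' i} :=
        ⟨hTD j _ (T j).start_mem_support, hne j hj _ (T j).start_mem_support⟩
      refine induce_connected_of_reachIn hxj ?_
      rintro z ⟨hzD, hzb⟩
      obtain ⟨k, hk⟩ := (hT.mem_iff z).mp hzD
      have hr : ReachIn G {z | z ∈ D ∧ z ≠ b' i} (x k) z := by
        by_cases hki : k = i
        · subst hki
          exact ((hT.isPath k).reachIn_of_ne_end hk hzb).mono fun w hw => ⟨hTD k w hw.1, hw.2⟩
        · exact reachIn_of_connected (s := {w | w ∈ (T k).support}) (T k).connected_induce_support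
            (fun w hw => ⟨hTD k w hw, hne k hki w hw⟩) (T k).start_mem_support hk
      by_cases hjk : j = k
      · rwa [hjk]
      · obtain ⟨p, hp⟩ := hr
        exact (ReachIn.of_adj hxj (hp _ p.start_mem_support) (hT.adj j k hjk)).trans ⟨p, hp⟩
    refine (hwheel _ (fun z hz => hz.1) hconn (fun l => ?_) (hb' i).1).2 rfl
    by_cases hl : l = i
    · subst hl
      exact ⟨w, ⟨hw, hwb⟩, hyw⟩
    · exact ⟨b' l, ⟨(hb' l).1, hne l hl _ (T l).end_mem_support⟩, (hb' l).2⟩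
  have hsupp : ∀ i z, z ∈ ((T i).concat (hb' i).2.symm).support ↔ z ∈ (T i).support ∨ z = y i :=
    fun i z => by
      rw [Walk.support_concat, List.mem_append, List.mem_singleton]
  have hdis : ∀ i j z, z ∈ ((T i).concat (hb' i).2.symm).support →
      z ∈ ((T j).concat (hb' j).2.symm).support → i = j := by
    intro i j z hi hj
    rcases (hsupp i z).mp hi with hi | rfl <;> rcases (hsupp j _).mp hj with hj | hj
    · exact hT.disjoint i j z hi hj
    · exact absurd hj (hTD i z hi j)
    · exact absurd rfl (hTD j _ hj i)
    · exact hy i j hj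
  have hmix : ∀ i, ∀ w ∈ D, G.Adj (y i) w →
      s(w, y i) ∈ ((T i).concat (hb' i).2.symm).edges := fun i w hw h => by
    rw [Walk.edges_concat, hedge i w hw h]
    simp
  refine ⟨x, y, hT.adj, hS.adj, fun i j => hTD i _ (T i).start_mem_support j,
    fun i => (T i).concat (hb' i).2.symm, fun i => ?_, fun i j hij z hi hj => hij (hdis i j z hi hj),
    fun i j z hi hj => ?_, fun z => ?_, fun z w hzw => ?_⟩
  · exact (hT.isPath i).concat (fun h => hTD i _ h i rfl) _
  · have : z ∈ ((T j).concat (hb' j).2.symm).support := by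
      rcases hj with rfl | rfl
      · exact Walk.start_mem_support _
      · exact Walk.end_mem_support _
    rwa [hdis i j z hi this]
  · by_cases hz : z ∈ D
    · obtain ⟨i, hi⟩ := (hT.mem_iff z).mp hz
      exact ⟨i, (hsupp i z).mpr (Or.inl hi)⟩
    · obtain ⟨i, rfl⟩ := hDy z hz
      exact ⟨i, Walk.end_mem_support _⟩
  · by_cases hz : z ∈ D <;> by_cases hw : w ∈ D
    · rcases hT.edge z hz w hw hzw with ⟨i, j, hij, h⟩ | ⟨i, hi⟩
      · exact Or.inl ⟨i, j, hij, Or.inl h⟩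
      · refine Or.inr ⟨i, ?_⟩
        rw [Walk.edges_concat]
        simp [hi]
    · obtain ⟨i, rfl⟩ := hDy w hw
      exact Or.inr ⟨i, hmix i z hz hzw.symm⟩
    · obtain ⟨i, rfl⟩ := hDy z hz
      exact Or.inr ⟨i, Sym2.eq_swap ▸ hmix i w hw hzw⟩
    · obtain ⟨i, rfl⟩ := hDy z hz
      obtain ⟨j, rfl⟩ := hDy w hw
      exact Or.inl ⟨i, j, fun h => hzw.ne (congrArg y h), Or.inr ⟨rfl, rfl⟩⟩

/-- If a connected `K₄`-minimal graph `G` contains two vertex-disjoint cycles `c₁, c₂`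
and three pairwise vertex-disjoint edges `(a i) (b i)` with `a i` on `c₁` and `b i`
off `c₁`, then `G` consists of two vertex-disjoint triangles joined by three pairwise
vertex-disjoint paths, internally disjoint from the triangles, covering `G`. -/
theorem k4_minimal_two_cycles (G : SimpleGraph α) (hconn : G.Connected)
    (hmin : MinorMinimal G (⊤ : SimpleGraph (Fin 4)))
    (x₁ x₂ : α) (c₁ : G.Walk x₁ x₁) (c₂ : G.Walk x₂ x₂)
    (hc₁ : c₁.IsCycle) (hc₂ : c₂.IsCycle)
    (hdisj : ∀ z, z ∈ c₁.support → z ∉ c₂.support)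
    (a b : Fin 3 → α)
    (hab : ∀ i, G.Adj (a i) (b i))
    (haC : ∀ i, a i ∈ c₁.support)
    (hbC : ∀ i, b i ∉ c₁.support)
    (hpairwise : ∀ i j, i ≠ j → a i ≠ a j ∧ a i ≠ b j ∧ b i ≠ b j) :
    TwoTrianglesThreePaths G := by
  obtain ⟨y, S, hS⟩ := exists_isNet_compl_cycle hconn hmin hc₁ hc₂ hdisj
    (fun i j h => by_contra fun hij => (hpairwise i j hij).1 h) hab haC hbC
  exact IsNet.twoTrianglesThreePaths hmin (C := {z | z ∈ c₁.support}) c₁.connected_induce_support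
    c₁.support.finite_toSet (fun x hx => hc₁.exists_two_adj hx) haC hab hS
end
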